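/- arXiv:2601.14585 — 2 statements merged into one kernel-verified Lean document; each statement's English description precedes it below -/
import Mathlib

section
/- Let n and k be integers with 2k+1 ≤ n and let Pₙᵏ be a cyclic polygon with n vertices all of whose edges have length k. Then every maximal star decomposition of Pₙᵏ is a k-star decomposition, i.e., every star in it is a k-star. -/
open Complex
open scoped Classical

noncomputable section

/-- The anticlockwise arc displacement from `u` to `v` on the unit circle, lying in `(0, 2π]`
(equal to `2π` when `v = u`). -/
def posArc (u v : ℂ) : ℝ :=
  if 0 < Complex.arg (v / u) then Complex.arg (v / u) else Complex.arg (v / u) + 2 * Real.pi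

/-- `u, v, w` occur in anticlockwise order on the circle. -/
def ACW (u v w : ℂ) : Prop :=
  u ≠ v ∧ v ≠ w ∧ u ≠ w ∧ posArc u v < posArc u w

/-- The open anticlockwise arc from `u` to `v`. -/
def arcOO (u v : ℂ) : Set ℂ := {x | x ≠ u ∧ x ≠ v ∧ posArc u x < posArc u v}

/-- The anticlockwise arc from `u` to `v`, open at `u` and closed at `v`. -/
def arcOC (u v : ℂ) : Set ℂ := {x | x ≠ u ∧ (x = v ∨ posArc u x < posArc u v)}

/-- The closed anticlockwise arc from `u` to `v`. -/
def arcCC (u v : ℂ) : Set ℂ := {x | x = u ∨ x = v ∨ (x ≠ u ∧ posArc u x < posArc u v)}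

/-- The (undirected) angle `∠ x v z` at apex `v`. -/
def vangle (x v z : ℂ) : ℝ := |Complex.arg ((x - v) / (z - v))|

/-- A cyclic polygon: a finite set of vertices on the unit circle together with a set of
directed edges such that every vertex has indegree and outdegree one, and any two
consecutive edges `uv`, `vw` have `u, v, w` in anticlockwise order. -/
structure CyclicPolygon where
  V : Finset ℂ
  E : Finset (ℂ × ℂ)
  nonempty : V.Nonempty
  onCircle : ∀ v ∈ V, ‖v‖ = 1
  endmem : ∀ e ∈ E, e.1 ∈ V ∧ e.2 ∈ V
  outdeg : ∀ v ∈ V, ∃! w, (v, w) ∈ E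
  indeg : ∀ v ∈ V, ∃! u, (u, v) ∈ E
  acw : ∀ u v w : ℂ, (u, v) ∈ E → (v, w) ∈ E → ACW u v w

namespace CyclicPolygon

/-- The successor `v⁺` of a vertex. -/
noncomputable def next (P : CyclicPolygon) (v : ℂ) : ℂ :=
  if h : ∃ w, (v, w) ∈ P.E then h.choose else v

/-- The predecessor `v⁻` of a vertex. -/
noncomputable def prev (P : CyclicPolygon) (v : ℂ) : ℂ :=
  if h : ∃ u, (u, v) ∈ P.E then h.choose else v

end CyclicPolygon

/-- The interior angle `∠ v⁻ v v⁺` of `P` at `v`. -/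
def interiorAngle (P : CyclicPolygon) (v : ℂ) : ℝ :=
  vangle (P.prev v) v (P.next v)

/-- The length of an edge `uv`: the number of vertices on the open anticlockwise
arc from `u` to `v`, plus one. -/
def edgeLength (P : CyclicPolygon) (u v : ℂ) : ℕ :=
  ((P.V : Set ℂ) ∩ arcOO u v).ncard + 1

/-- A `k`-star: a cyclic polygon with `2k+1` vertices all of whose edges have length `k`. -/
def IsKStar (S : CyclicPolygon) (k : ℕ) : Prop :=
  S.V.card = 2 * k + 1 ∧ ∀ e ∈ S.E, edgeLength S e.1 e.2 = k

/-- A star: a `k`-star for some positive integer `k`. -/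
def IsStar (S : CyclicPolygon) : Prop := ∃ k : ℕ, 0 < k ∧ IsKStar S k

/-- The segment from `u` to `x` splits the interior angle `∠ u⁻ u u⁺` of `S` at `u`
into the two (smaller, nonzero) angles `∠ u⁻ u x` and `∠ x u u⁺`. -/
def SplitsVertexAngle (S : CyclicPolygon) (u x : ℂ) : Prop :=
  u ∈ S.V ∧ 0 < vangle (S.prev u) u x ∧ 0 < vangle x u (S.next u) ∧
    vangle (S.prev u) u x + vangle x u (S.next u) = vangle (S.prev u) u (S.next u)

/-- `(u, v)` is a linkable pair for the pair of cyclic polygons `(S₁, S₂)`: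
the segment `uv` splits the angle of `S₁` at `u` and the angle of `S₂` at `v`. -/
def LinkablePair (S₁ S₂ : CyclicPolygon) (u v : ℂ) : Prop :=
  u ≠ v ∧ SplitsVertexAngle S₁ u v ∧ SplitsVertexAngle S₂ v u

/-- `u, v` is a linkable pair of vertices of the cyclic polygon `P`. -/
def Linkable (P : CyclicPolygon) (u v : ℂ) : Prop := LinkablePair P P u v

/-- `D` is a set of (undirected) diagonals of `P`, i.e. every member joins a linkable pair. -/
def IsDiagonalSet (P : CyclicPolygon) (D : Set (Sym2 ℂ)) : Prop :=
  ∀ u v : ℂ, s(u, v) ∈ D → Linkable P u v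

/-- The set `D̃` of directed edges associated to a set of diagonals `D`. -/
def tilde (D : Set (Sym2 ℂ)) : Set (ℂ × ℂ) := {e | s(e.1, e.2) ∈ D}

/-- The segment from `v` towards `x` splits the angle `∠ u v w`. -/
def SplitsAngle3 (u v w x : ℂ) : Prop :=
  0 < vangle u v x ∧ 0 < vangle x v w ∧ vangle u v x + vangle x v w = vangle u v w

/-- `𝒮` is a star decomposition of `P` with respect to the diagonal set `D`: the
cycle decomposition of `E ∪ D̃` determined by `f_next` (each cycle follows the
tightest turn, i.e. no diagonal of `D` splits the angle between two consecutive
edges of a cycle), all of whose cycles are stars. -/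
def IsStarDecomp (P : CyclicPolygon) (D : Set (Sym2 ℂ)) (𝒮 : Finset CyclicPolygon) : Prop :=
  IsDiagonalSet P D ∧
  (∀ S ∈ 𝒮, IsStar S ∧ (S.V : Set ℂ) ⊆ (P.V : Set ℂ)) ∧
  (∀ S ∈ 𝒮, (S.E : Set (ℂ × ℂ)) ⊆ (P.E : Set (ℂ × ℂ)) ∪ tilde D) ∧
  (∀ e ∈ (P.E : Set (ℂ × ℂ)) ∪ tilde D, ∃ S ∈ 𝒮, e ∈ S.E) ∧
  (∀ S₁ ∈ 𝒮, ∀ S₂ ∈ 𝒮, S₁ ≠ S₂ → ∀ e : ℂ × ℂ, e ∈ S₁.E → e ∉ S₂.E) ∧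
  (∀ S ∈ 𝒮, ∀ u v w : ℂ, (u, v) ∈ S.E → (v, w) ∈ S.E →
      ¬ ∃ x, s(v, x) ∈ D ∧ SplitsAngle3 u v w x)

/-- `P` admits a star decomposition with respect to `D`. -/
def HasStarDecomp (P : CyclicPolygon) (D : Set (Sym2 ℂ)) : Prop :=
  ∃ 𝒮 : Finset CyclicPolygon, IsStarDecomp P D 𝒮

/-- A maximal star decomposition: no proper superset of `D` admits a star decomposition. -/
def IsMaximalStarDecomp (P : CyclicPolygon) (D : Set (Sym2 ℂ))
    (𝒮 : Finset CyclicPolygon) : Prop :=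
  IsStarDecomp P D 𝒮 ∧ ∀ D' : Set (Sym2 ℂ), D ⊂ D' → ¬ HasStarDecomp P D'

/-- `D'` is obtained from `D` by a diagonal flip: remove one diagonal and add another. -/
def FlipStep (D D' : Set (Sym2 ℂ)) : Prop :=
  ∃ e f : Sym2 ℂ, e ∈ D ∧ f ∉ D ∧ D' = (D \ {e}) ∪ {f}

/-- The two chords `ab` and `cd` are crossing: they share no endpoint and
intersect inside the circle. -/
def Crossing (a b c d : ℂ) : Prop :=
  a ≠ c ∧ a ≠ d ∧ b ≠ c ∧ b ≠ d ∧ (openSegment ℝ a b ∩ openSegment ℝ c d).Nonempty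

/-- The two chords `ab` and `cd` share a common point: they have a common
endvertex or intersect inside the circle. -/
def ShareCommonPoint (a b c d : ℂ) : Prop :=
  a = c ∨ a = d ∨ b = c ∨ b = d ∨ (openSegment ℝ a b ∩ openSegment ℝ c d).Nonempty

/-- Two cyclic polygons have a pair of overlapped angles: a common vertex `y` and a vertex
`x` of either polygon lying on both arcs `⦅y⁺ y⁻⟧` (taken in each polygon). -/
def OverlappedAngles (S₁ S₂ : CyclicPolygon) : Prop :=
  ∃ y : ℂ, y ∈ S₁.V ∧ y ∈ S₂.V ∧
    ∃ x : ℂ, (x ∈ S₁.V ∨ x ∈ S₂.V) ∧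
      x ∈ arcOC (S₁.next y) (S₁.prev y) ∧ x ∈ arcOC (S₂.next y) (S₂.prev y)

/-- Two cyclic polygons are mutually independent: no two of their angles are overlapped. -/
def IndepPolygons (S₁ S₂ : CyclicPolygon) : Prop := ¬ OverlappedAngles S₁ S₂

/-- The edge `uv` of `P` is minimal: no edge `xy` of `P` has all vertices of the closed
arc from `x` to `y` inside the open arc from `u` to `v`. -/
def MinimalEdge (P : CyclicPolygon) (u v : ℂ) : Prop :=
  (u, v) ∈ P.E ∧
    ¬ ∃ x y : ℂ, (x, y) ∈ P.E ∧ ∀ z ∈ P.V, z ∈ arcCC x y → z ∈ arcOO u v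

/-- `vs` enumerates the star `S` as `v₀ v₁ ⋯ v₂ₖ` with `v₁ = v`, `v₀ = v⁻` (so that `v⁻v`
is an edge of `S`), each edge of `S` is an edge of `P` or a diagonal of `P`, and all the
edges `v₂ᵢ₋₁v₂ᵢ` are edges of `P`. -/
def IsBorderCandidate (P : CyclicPolygon) (v : ℂ) (S : CyclicPolygon) (k : ℕ)
    (vs : ℕ → ℂ) : Prop :=
  0 < k ∧ IsStar S ∧ S.V.card = 2 * k + 1 ∧
  (S.V : Set ℂ) ⊆ (P.V : Set ℂ) ∧
  vs 0 = P.prev v ∧ vs 1 = v ∧ vs (2 * k + 1) = vs 0 ∧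
  (∀ x ∈ S.V, ∃ i ≤ 2 * k, vs i = x) ∧
  (∀ i ≤ 2 * k, (vs i, vs (i + 1)) ∈ S.E) ∧
  (∀ i ≤ 2 * k, (vs i, vs (i + 1)) ∈ P.E ∨ Linkable P (vs i) (vs (i + 1))) ∧
  (∀ i : ℕ, 1 ≤ i → i ≤ k → (vs (2 * i - 1), vs (2 * i)) ∈ P.E)

/-- The angle sequence `(∠v₁v₂v₃, ∠v₃v₄v₅, …, ∠v₂ₖ₋₁v₂ₖv₀)` of an enumerated star. -/
noncomputable def angleList (vs : ℕ → ℂ) (k : ℕ) : List ℝ :=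
  (List.range k).map fun i => vangle (vs (2 * i + 1)) (vs (2 * i + 2)) (vs (2 * i + 3))

/-- `S` is the border star `S*(P, v)`: among all border candidates, its angle sequence is
lexicographically minimal. -/
def IsBorderStar (P : CyclicPolygon) (v : ℂ) (S : CyclicPolygon) : Prop :=
  ∃ (k : ℕ) (vs : ℕ → ℂ), IsBorderCandidate P v S k vs ∧
    ∀ (S' : CyclicPolygon) (k' : ℕ) (vs' : ℕ → ℂ), IsBorderCandidate P v S' k' vs' →
      ¬ List.Lex (· < ·) (angleList vs' k') (angleList vs k)



lemma posArc_exp (z : ℂ) (hz : z ≠ 0) (δ : ℝ) (h0 : 0 < δ) (h1 : δ ≤ 2 * Real.pi) :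
    posArc z (z * exp (δ * I)) = δ := by
  have hpi := Real.pi_pos
  unfold posArc
  rw [mul_div_cancel_left₀ _ hz]
  by_cases h : δ ≤ Real.pi
  · have : arg (exp (δ * I)) = δ := by
      rw [Complex.arg_exp_mul_I, toIocMod_eq_self]
      constructor <;> linarith
    rw [this, if_pos h0]
  · have : arg (exp (δ * I)) = δ - 2 * Real.pi := by
      have h2 : exp (δ * I) = exp (((δ - 2 * Real.pi : ℝ) : ℂ) * I) := by
        push_cast
        rw [sub_mul, exp_sub, Complex.exp_two_pi_mul_I, div_one]
      rw [h2, Complex.arg_exp_mul_I, toIocMod_eq_self]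
      constructor <;> linarith
    rw [this, if_neg (by linarith)]
    ring

lemma posArc_spec (u v : ℂ) (hu : ‖u‖ = 1) (hv : ‖v‖ = 1) :
    0 < posArc u v ∧ posArc u v ≤ 2 * Real.pi ∧ v = u * exp (posArc u v * I) := by
  have hpi := Real.pi_pos
  have hu0 : u ≠ 0 := by
    intro h; rw [h] at hu; simp at hu
  have h1 : exp (arg (v / u) * I) = v / u := by
    have := Complex.norm_mul_exp_arg_mul_I (v / u)
    rwa [norm_div, hu, hv, div_one, ofReal_one, one_mul] at this
  have h2 := Complex.neg_pi_lt_arg (v / u)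
  have h3 := Complex.arg_le_pi (v / u)
  unfold posArc
  split_ifs with h
  · refine ⟨h, by linarith, ?_⟩
    rw [h1]; field_simp
  · refine ⟨by linarith, by linarith, ?_⟩
    push_cast
    rw [add_mul, exp_add, Complex.exp_two_pi_mul_I, h1]; field_simp

lemma exp_sub_one_eq (α : ℝ) :
    exp (α * I) - 1 = ((2 * Real.sin (α / 2) : ℝ) : ℂ) * exp (((α / 2 : ℝ) : ℂ) * I) * I := by
  have e1 : exp (α * I) = exp (((α / 2 : ℝ) : ℂ) * I) * exp (((α / 2 : ℝ) : ℂ) * I) := by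
    rw [← exp_add]; congr 1; push_cast; ring
  have hs := Complex.sin_sq_add_cos_sq ((α / 2 : ℝ) : ℂ)
  rw [e1, Complex.exp_mul_I]
  push_cast at *
  linear_combination hs + (sin ((α:ℂ)/2))^2 * (1 - 2) * I_sq

lemma vangle_exp (v : ℂ) (hv : v ≠ 0) (α β : ℝ) (ha : 0 < α) (ha' : α < 2 * Real.pi)
    (hb : 0 < β) (hb' : β < 2 * Real.pi) :
    vangle (v * exp (α * I)) v (v * exp (β * I)) = |α - β| / 2 := by
  have hpi := Real.pi_pos
  have sa : 0 < Real.sin (α / 2) := Real.sin_pos_of_pos_of_lt_pi (by linarith) (by linarith)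
  have sb : 0 < Real.sin (β / 2) := Real.sin_pos_of_pos_of_lt_pi (by linarith) (by linarith)
  have h : (v * exp (α * I) - v) / (v * exp (β * I) - v) =
      ((Real.sin (α / 2) / Real.sin (β / 2) : ℝ) : ℂ) * exp ((((α - β) / 2 : ℝ) : ℂ) * I) := by
    have e1 : v * exp (α * I) - v = v * (exp (α * I) - 1) := by ring
    have e2 : v * exp (β * I) - v = v * (exp (β * I) - 1) := by ring
    have e3 : exp ((((α - β) / 2 : ℝ) : ℂ) * I) =
        exp (((α / 2 : ℝ) : ℂ) * I) / exp (((β / 2 : ℝ) : ℂ) * I) := by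
      rw [← exp_sub]; congr 1; push_cast; ring
    rw [e1, e2, mul_div_mul_left _ _ hv, exp_sub_one_eq, exp_sub_one_eq, e3]
    have sb' : ((Real.sin (β / 2) : ℝ) : ℂ) ≠ 0 := by exact_mod_cast sb.ne'
    have := I_ne_zero
    have := exp_ne_zero (((β / 2 : ℝ) : ℂ) * I)
    rw [ofReal_mul, ofReal_mul, ofReal_div (Real.sin _)]
    field_simp
  unfold vangle
  rw [h, Complex.arg_real_mul _ (div_pos sa sb), Complex.arg_exp_mul_I, (toIocMod_eq_self _).2, abs_div]
  · norm_num
  · constructor <;> linarith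

/-- Enumeration of a finite set of points of the circle by the integers, anticlockwise and
periodic. -/
structure Enum (V : Finset ℂ) (n : ℤ) (e : ℤ → ℂ) : Prop where
  npos : 0 < n
  card : (V.card : ℤ) = n
  per : ∀ i, e (i + n) = e i
  mem : ∀ i, e i ∈ V
  surj : ∀ v ∈ V, ∀ i, ∃ j, i ≤ j ∧ j < i + n ∧ e j = v
  inj : ∀ i j, i ≤ j → j < i + n → e i = e j → i = j
  arc : ∀ i j l, i < j → j < i + n → i < l → l < i + n →
    (posArc (e i) (e j) < posArc (e i) (e l) ↔ j < l)
  split : ∀ i j l x, i < j → j < l → l < i + n → i < x → x < i + n →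
    (SplitsAngle3 (e l) (e i) (e j) (e x) ↔ j < x ∧ x < l)

lemma enum_of_theta (V : Finset ℂ) (n : ℤ) (hn : 0 < n) (hcard : (V.card : ℤ) = n) (v0 : ℂ) (hv0 : ‖v0‖ = 1)
    (θ : ℤ → ℝ) (hm : StrictMono θ) (hp : ∀ i, θ (i + n) = θ i + 2 * Real.pi)
    (hmem : ∀ i, v0 * exp (θ i * I) ∈ V) (hsurj : ∀ v ∈ V, ∃ i, v0 * exp (θ i * I) = v) :
    Enum V n (fun i => v0 * exp (θ i * I)) := by
  have hper : ∀ i, v0 * exp (θ (i + n) * I) = v0 * exp (θ i * I) := by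
    intro i
    rw [hp]; push_cast
    rw [add_mul, exp_add, Complex.exp_two_pi_mul_I, mul_one]
  have hv00 : v0 ≠ 0 := by
    intro h; rw [h] at hv0; simp at hv0
  have hne : ∀ i, v0 * exp (θ i * I) ≠ 0 := fun i => mul_ne_zero hv00 (exp_ne_zero _)
  have hrel : ∀ i j, v0 * exp (θ j * I) = (v0 * exp (θ i * I)) * exp ((θ j - θ i : ℝ) * I) := by
    intro i j
    rw [mul_assoc, ← exp_add]; congr 2; push_cast; ring
  have hb : ∀ i j, i < j → j < i + n → 0 < θ j - θ i ∧ θ j - θ i < 2 * Real.pi := by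
    intro i j h1 h2
    have := hm h1
    have := hm h2
    rw [hp] at this
    constructor <;> linarith
  have hpa : ∀ i j, i < j → j < i + n →
      posArc (v0 * exp (θ i * I)) (v0 * exp (θ j * I)) = θ j - θ i := by
    intro i j h1 h2
    rw [hrel i j]
    exact posArc_exp _ (hne i) _ (hb i j h1 h2).1 (hb i j h1 h2).2.le
  have hva : ∀ i j l, i < j → j < i + n → i < l → l < i + n →
      vangle (v0 * exp (θ j * I)) (v0 * exp (θ i * I)) (v0 * exp (θ l * I)) = |θ j - θ l| / 2 := by
    intro i j l h1 h2 h3 h4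
    rw [hrel i j, hrel i l, vangle_exp _ (hne i) _ _ (hb i j h1 h2).1 (hb i j h1 h2).2 (hb i l h3 h4).1 (hb i l h3 h4).2]
    congr 2; ring
  refine ⟨hn, hcard, hper, hmem, ?_, ?_, ?_, ?_⟩
  · intro v hv i
    obtain ⟨j, hj⟩ := hsurj v hv
    have hper' : ∀ t : ℕ, ∀ i, v0 * exp (θ (i + t * n) * I) = v0 * exp (θ i * I) := by
      intro t
      induction t with
      | zero => intro i; simp
      | succ t ih =>
        intro i
        rw [← ih i, ← hper (i + t * n)]
        congr 5; push_cast; ring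
    have hperz : ∀ t : ℤ, ∀ i, v0 * exp (θ (i + t * n) * I) = v0 * exp (θ i * I) := by
      intro t i
      obtain ⟨s, rfl | rfl⟩ := t.eq_nat_or_neg
      · exact hper' s i
      · rw [← hper' s (i + -s * n)]; congr 5; ring
    refine ⟨i + (j - i) % n, ?_, ?_, ?_⟩
    · have := Int.emod_nonneg (j - i) hn.ne'; linarith
    · have := Int.emod_lt_of_pos (j - i) hn; linarith
    · rw [← hj, ← hperz ((j - i) / n) (i + (j - i) % n)]
      congr 5
      have := Int.emod_add_mul_ediv (j - i) n
      linarith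
  · intro i j h1 h2 h
    by_contra hc
    have h3 : i < j := lt_of_le_of_ne h1 hc
    have h4 := hpa i j h3 h2
    have h5 : posArc (v0 * exp (θ i * I)) (v0 * exp (θ j * I)) = 2 * Real.pi := by
      rw [← show v0 * exp (θ i * I) = v0 * exp (θ j * I) from h]
      have := posArc_exp (v0 * exp (θ i * I)) (hne i) (2 * Real.pi) (by positivity) le_rfl
      push_cast at this
      rwa [Complex.exp_two_pi_mul_I, mul_one] at this
    have := (hb i j h3 h2).2
    linarith
  · intro i j l h1 h2 h3 h4
    rw [hpa i j h1 h2, hpa i l h3 h4, sub_lt_sub_iff_right, hm.lt_iff_lt]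
  · intro i j l x h1 h2 h3 h4 h5
    unfold SplitsAngle3
    rw [hva i l x (h1.trans h2) h3 h4 h5, hva i x j h4 h5 h1 (h2.trans h3),
      hva i l j (h1.trans h2) h3 h1 (h2.trans h3), ← hm.lt_iff_lt (a := j) (b := x), ← hm.lt_iff_lt (a := x) (b := l)]
    have h6 := hm h2
    rw [abs_of_pos (show 0 < θ l - θ j by linarith)]
    constructor
    · rintro ⟨a1, a2, a3⟩
      rcases abs_cases (θ l - θ x) with h | h <;> rcases abs_cases (θ x - θ j) with h' | h' <;>
        constructor <;> linarith
    · rintro ⟨a1, a2⟩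
      rw [abs_of_pos (show 0 < θ l - θ x by linarith), abs_of_pos (show 0 < θ x - θ j by linarith)]
      refine ⟨by linarith, by linarith, by linarith⟩

lemma exists_enum (V : Finset ℂ) (hV : V.Nonempty) (hc : ∀ v ∈ V, ‖v‖ = 1) :
    ∃ e, Enum V (V.card : ℤ) e := by
  obtain ⟨v0, hv0⟩ := hV
  have h0 := hc v0 hv0
  have hspec : ∀ v ∈ V, _ := fun v hv => posArc_spec v0 v h0 (hc v hv)
  have hpi := Real.pi_pos
  set B := V.image (posArc v0) with hB
  have hcB : B.card = V.card := by
    apply Finset.card_image_of_injOn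
    intro x hx y hy hxy
    rw [(hspec x hx).2.2, (hspec y hy).2.2]
    rw [hxy]
  set f := B.orderEmbOfFin hcB with hf
  have hcp : 0 < V.card := Finset.card_pos.2 ⟨v0, hv0⟩
  have hcz : (0 : ℤ) < V.card := by exact_mod_cast hcp
  have hr : ∀ i : ℤ, (i % V.card).toNat < V.card := by
    intro i
    have := Int.emod_lt_of_pos i hcz
    omega
  have hfb : ∀ j, 0 < f j ∧ f j ≤ 2 * Real.pi := by
    intro j
    have : f j ∈ B := Finset.orderEmbOfFin_mem _ _ _
    rw [hB, Finset.mem_image] at this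
    obtain ⟨v, hv, h⟩ := this
    rw [← h]
    exact ⟨(hspec v hv).1, (hspec v hv).2.1⟩
  let θ : ℤ → ℝ := fun i => f ⟨(i % V.card).toNat, hr i⟩ + 2 * Real.pi * ((i / V.card : ℤ) : ℝ)
  have hexp : ∀ i, v0 * exp (θ i * I) = v0 * exp ((f ⟨(i % V.card).toNat, hr i⟩ : ℝ) * I) := by
    intro i
    simp only [θ]
    push_cast
    rw [add_mul, exp_add]
    have : exp (2 * (Real.pi : ℂ) * ((i / V.card : ℤ) : ℂ) * I) = 1 := by
      rw [Complex.exp_eq_one_iff]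
      exact ⟨i / V.card, by ring⟩
    rw [this, mul_one]
  refine ⟨_, enum_of_theta V _ hcz rfl v0 h0 θ ?_ ?_ ?_ ?_⟩
  · apply strictMono_int_of_lt_succ
    intro i
    have a1 := Int.emod_lt_of_pos i hcz
    have a0 := Int.emod_nonneg i hcz.ne'
    have a2 := Int.emod_add_mul_ediv i V.card
    simp only [θ]
    by_cases h : i % V.card + 1 < V.card
    · have b1 : (i + 1) % V.card = i % V.card + 1 := by
        rw [← Int.emod_emod_of_dvd _ (dvd_refl _)]
        rw [Int.add_emod, Int.emod_emod_of_dvd _ (dvd_refl _)]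
        by_cases h1 : (V.card : ℤ) = 1
        · omega
        · rw [Int.emod_eq_of_lt (a := 1) (by norm_num) (by omega), Int.emod_eq_of_lt (by omega) h]
      have b2 : (i + 1) / V.card = i / V.card := by
        have a3 := Int.emod_add_mul_ediv (i + 1) V.card
        have : (V.card : ℤ) * ((i + 1) / V.card) = V.card * (i / V.card) := by linarith
        exact mul_left_cancel₀ hcz.ne' this
      rw [b2]
      have : f ⟨(i % V.card).toNat, hr i⟩ < f ⟨((i + 1) % V.card).toNat, hr (i + 1)⟩ := by
        apply f.strictMono
        rw [Fin.mk_lt_mk]; omega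
      linarith
    · have b2 : (i + 1) / V.card = i / V.card + 1 := by
        have : i + 1 = V.card * (i / V.card + 1) := by linarith [show i % V.card + 1 = V.card by omega]
        rw [this, Int.mul_ediv_cancel_left _ hcz.ne']
      have b1 : (i + 1) % V.card = 0 := by
        have a3 := Int.emod_add_mul_ediv (i + 1) V.card
        rw [b2] at a3
        linarith [show i % V.card + 1 = V.card by omega]
      rw [b2]
      push_cast
      have c1 := (hfb ⟨(i % V.card).toNat, hr i⟩).2
      have c2 := (hfb ⟨((i + 1) % V.card).toNat, hr (i + 1)⟩).1
      linarith
  · intro i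
    simp only [θ]
    have : (i + V.card) / V.card = i / V.card + 1 := Int.add_ediv_of_dvd_right (dvd_refl _) |>.trans (by rw [Int.ediv_self hcz.ne'])
    rw [this]
    simp only [Int.add_emod_right]
    push_cast; ring
  · intro i
    rw [hexp]
    have : f ⟨(i % V.card).toNat, hr i⟩ ∈ B := Finset.orderEmbOfFin_mem _ _ _
    rw [hB, Finset.mem_image] at this
    obtain ⟨v, hv, h⟩ := this
    rw [← h, ← (hspec v hv).2.2]
    exact hv
  · intro v hv
    have : posArc v0 v ∈ Set.range f := by
      rw [hf, Finset.range_orderEmbOfFin]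
      exact Finset.mem_image_of_mem _ hv
    obtain ⟨j, hj⟩ := this
    refine ⟨(j : ℕ), ?_⟩
    rw [hexp]
    have : (⟨(((j : ℕ) : ℤ) % V.card).toNat, hr _⟩ : Fin V.card) = j := by
      ext
      simp only
      rw [Int.emod_eq_of_lt (by omega) (by exact_mod_cast j.2)]
      simp
    rw [this, hj, ← (hspec v hv).2.2]



/-- Integer model of a star: a step function counting vertices. -/
structure IStar (n : ℤ) (F : ℤ → ℤ) (m : ℤ) : Prop where
  pos : 1 ≤ m
  step : ∀ x, F (x + 1) = F x ∨ F (x + 1) = F x + 1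
  per : ∀ x, F (x + n) = F x + 2 * m + 1

def IMem (F : ℤ → ℤ) (u : ℤ) : Prop := F (u + 1) = F u + 1
def IEdge (F : ℤ → ℤ) (m u w : ℤ) : Prop := IMem F u ∧ IMem F w ∧ F w = F u + m
def ISec (F : ℤ → ℤ) (m u x : ℤ) : Prop := IMem F u ∧ F (x + 1) = F u + m + 1

lemma step_mono {F : ℤ → ℤ} (h : ∀ x, F (x + 1) = F x ∨ F (x + 1) = F x + 1) {x y : ℤ}
    (hxy : x ≤ y) : F x ≤ F y := by
  induction y, hxy using Int.leInduction with
  | base => exact le_rfl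
  | succ y hy ih => rcases h y with h | h <;> omega

namespace IStar
variable {n m : ℤ} {F : ℤ → ℤ}

lemma mono (h : IStar n F m) {x y : ℤ} (hxy : x ≤ y) : F x ≤ F y := step_mono h.step hxy

lemma lt_of (h : IStar n F m) {x y : ℤ} (hxy : F x < F y) : x < y := by
  by_contra hc
  have := h.mono (not_lt.1 hc)
  omega

lemma uniq (h : IStar n F m) {x y : ℤ} (hx : IMem F x) (hy : IMem F y) (hxy : F x = F y) : x = y := by
  unfold IMem at *
  have h1 := @lt_of _ _ _ h x (y + 1) (by omega)
  have h2 := @lt_of _ _ _ h y (x + 1) (by omega)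
  omega

lemma per_nat (h : IStar n F m) (t : ℕ) : ∀ x, F (x + t * n) = F x + t * (2 * m + 1) := by
  induction t with
  | zero => intro x; simp
  | succ t ih =>
    intro x
    have h1 := h.per (x + t * n)
    have h2 := ih x
    push_cast
    rw [show x + ((t : ℤ) + 1) * n = x + t * n + n by ring, h1, h2]; ring

lemma hit (h : IStar n F m) (y : ℤ) : ∃ x, F x = y ∧ IMem F x := by
  have hp := h.pos
  have hb : ∃ b, ∀ z, F z ≤ y → z ≤ b := by
    refine ⟨0 + ((y - F 0).toNat + 1 : ℕ) * n, fun z hz => ?_⟩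
    have h1 := h.per_nat ((y - F 0).toNat + 1) 0
    apply le_of_lt
    apply h.lt_of
    rw [h1]
    push_cast
    have : (y - F 0) ≤ ((y - F 0).toNat : ℤ) := Int.self_le_toNat _
    have h0 : (0:ℤ) ≤ ((y - F 0).toNat : ℤ) := by positivity
    nlinarith
  have hne : ∃ z, F z ≤ y := by
    refine ⟨-((F 0 - y).toNat : ℤ) * n, ?_⟩
    have h1 := h.per_nat ((F 0 - y).toNat) (-((F 0 - y).toNat : ℤ) * n)
    rw [show -((F 0 - y).toNat : ℤ) * n + ((F 0 - y).toNat : ℤ) * n = 0 by ring] at h1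
    have : (F 0 - y) ≤ ((F 0 - y).toNat : ℤ) := Int.self_le_toNat _
    have h0 : (0:ℤ) ≤ ((F 0 - y).toNat : ℤ) := by positivity
    nlinarith
  obtain ⟨x, hx, hmax⟩ := Int.exists_greatest_of_bdd hb hne
  have h1 : ¬ F (x + 1) ≤ y := fun hc => by have := hmax _ hc; omega
  unfold IMem
  refine ⟨x, ?_, ?_⟩ <;> rcases h.step x with h | h <;> omega

lemma mem_shift (h : IStar n F m) (u : ℤ) : IMem F (u + n) ↔ IMem F u := by
  unfold IMem
  have h1 := h.per u
  have h2 := h.per (u + 1)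
  rw [show u + n + 1 = u + 1 + n by ring]
  omega

lemma edge_shift (h : IStar n F m) (u w : ℤ) : IEdge F m (u + n) (w + n) ↔ IEdge F m u w := by
  unfold IEdge
  rw [h.mem_shift, h.mem_shift, h.per, h.per]
  have : F w + 2 * m + 1 = F u + 2 * m + 1 + m ↔ F w = F u + m := by omega
  rw [this]

lemma sec_shift (h : IStar n F m) (u w : ℤ) : ISec F m (u + n) (w + n) ↔ ISec F m u w := by
  unfold ISec
  rw [h.mem_shift, show w + n + 1 = w + 1 + n by ring, h.per, h.per]
  have : F (w + 1) + 2 * m + 1 = F u + 2 * m + 1 + m + 1 ↔ F (w + 1) = F u + m + 1 := by omega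
  rw [this]

lemma npos (h : IStar n F m) : 0 < n := by
  have h1 := h.per 0
  have h2 := h.pos
  exact h.lt_of (x := 0) (y := n) (by rw [zero_add] at h1; omega)

lemma edge_lt (h : IStar n F m) {u w : ℤ} (he : IEdge F m u w) : u < w ∧ w < u + n := by
  obtain ⟨_, _, h3⟩ := he
  have h1 := h.per u
  have h2 := h.pos
  exact ⟨h.lt_of (by omega), h.lt_of (by omega)⟩

end IStar

lemma exists_cnt (T : ℤ → Prop) : ∃ F : ℤ → ℤ, ∀ x, (T x → F (x + 1) = F x + 1) ∧ (¬ T x → F (x + 1) = F x) := by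
  refine ⟨fun x => ((Finset.Ico 0 x).filter T).card - ((Finset.Ico x 0).filter T).card, fun x => ?_⟩
  suffices hs : ∀ x : ℤ, ((((Finset.Ico 0 (x + 1)).filter T).card : ℤ) - ((Finset.Ico (x + 1) 0).filter T).card) =
      ((Finset.Ico 0 x).filter T).card - ((Finset.Ico x 0).filter T).card + if T x then 1 else 0 by
    constructor
    · intro h; simp only; rw [hs, if_pos h]
    · intro h; simp only; rw [hs, if_neg h, add_zero]
  clear x
  intro x
  rcases le_or_gt 0 x with h | h
  · have e1 : Finset.Ico (x + 1) 0 = ∅ := Finset.Ico_eq_empty (by omega)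
    have e2 : Finset.Ico x 0 = ∅ := Finset.Ico_eq_empty (by omega)
    have e3 : Finset.Ico 0 (x + 1) = insert x (Finset.Ico 0 x) := by
      ext y; simp only [Finset.mem_Ico, Finset.mem_insert]; omega
    rw [e1, e2, e3, Finset.filter_insert]
    split_ifs
    · rw [Finset.card_insert_of_notMem (by simp)]; simp
    · simp
  · have e1 : Finset.Ico 0 (x + 1) = ∅ := Finset.Ico_eq_empty (by omega)
    have e2 : Finset.Ico 0 x = ∅ := Finset.Ico_eq_empty (by omega)
    have e3 : Finset.Ico x 0 = insert x (Finset.Ico (x + 1) 0) := by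
      ext y; simp only [Finset.mem_Ico, Finset.mem_insert]; omega
    rw [e1, e2, e3, Finset.filter_insert]
    split_ifs
    · rw [Finset.card_insert_of_notMem (by simp)]; simp
    · simp

lemma card_cnt {T : ℤ → Prop} [DecidablePred T] {F : ℤ → ℤ} (hF : ∀ x, (T x → F (x + 1) = F x + 1) ∧ (¬ T x → F (x + 1) = F x))
    {i j : ℤ} (hij : i ≤ j) : (((Finset.Ico i j).filter T).card : ℤ) = F j - F i := by
  induction j, hij using Int.leInduction with
  | base => simp
  | succ j hj ih =>
    have e3 : Finset.Ico i (j + 1) = insert j (Finset.Ico i j) := by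
      ext y; simp only [Finset.mem_Ico, Finset.mem_insert]; omega
    rw [e3, Finset.filter_insert]
    split_ifs with hT
    · rw [Finset.card_insert_of_notMem (by simp), (hF j).1 hT]; push_cast; rw [ih]; ring
    · rw [ih, (hF j).2 hT]

namespace Enum
variable {V : Finset ℂ} {n : ℤ} {e : ℤ → ℂ}

lemma per_nat (h : Enum V n e) (t : ℕ) : ∀ i, e (i + t * n) = e i := by
  induction t with
  | zero => intro i; simp
  | succ t ih =>
    intro i
    rw [← ih i, ← h.per (i + t * n)]
    congr 1; push_cast; ring

lemma per_int (h : Enum V n e) (t i : ℤ) : e (i + t * n) = e i := by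
  obtain ⟨s, rfl | rfl⟩ := t.eq_nat_or_neg
  · exact h.per_nat s i
  · rw [← h.per_nat s (i + -s * n)]; congr 1; ring

lemma eq_iff (h : Enum V n e) {i j : ℤ} (hij : e i = e j) : ∃ t : ℤ, j = i + t * n := by
  have hn := h.npos
  have h1 := Int.emod_nonneg (j - i) hn.ne'
  have h2 := Int.emod_lt_of_pos (j - i) hn
  have h3 := Int.emod_add_mul_ediv (j - i) n
  refine ⟨(j - i) / n, ?_⟩
  have h4 := h.inj i (i + (j - i) % n) (by omega) (by omega) (by
    rw [hij, ← h.per_int ((j - i) / n) (i + (j - i) % n)]; congr 1; linarith)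
  linarith

lemma eq_pair (h : Enum V n e) {i j i' j' : ℤ} (h1 : e i = e i') (h2 : e j = e j')
    (a1 : i < j) (a2 : j < i + n) (a3 : i' < j') (a4 : j' < i' + n) :
    ∃ t : ℤ, i' = i + t * n ∧ j' = j + t * n := by
  obtain ⟨t, ht⟩ := h.eq_iff h1
  obtain ⟨s, hs⟩ := h.eq_iff h2
  have hn := h.npos
  have : s = t := by
    have b1 : s < t + 1 := by
      by_contra hc
      nlinarith
    have b2 : t < s + 1 := by
      by_contra hc
      nlinarith
    omega
  subst this
  exact ⟨s, ht, hs⟩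

end Enum

lemma shift_inv {n : ℤ} {Q : ℤ → ℤ → Prop} (hQ : ∀ u w, Q (u + n) (w + n) ↔ Q u w) (t u w : ℤ) :
    Q (u + t * n) (w + t * n) ↔ Q u w := by
  have hnat : ∀ t : ℕ, ∀ u w, Q (u + t * n) (w + t * n) ↔ Q u w := by
    intro t
    induction t with
    | zero => intro u w; simp
    | succ t ih =>
      intro u w
      rw [← ih u w, ← hQ (u + t * n)]
      have : ∀ u : ℤ, u + ((t + 1 : ℕ) : ℤ) * n = u + t * n + n := by intro u; push_cast; ring
      rw [this, this]
  obtain ⟨s, rfl | rfl⟩ := t.eq_nat_or_neg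
  · exact hnat s u w
  · rw [← hnat s (u + -s * n)]
    have : ∀ u : ℤ, u + -(s : ℤ) * n + s * n = u := by intro u; ring
    rw [this, this]

structure StarRep (V : Finset ℂ) (n : ℤ) (e : ℤ → ℂ) (S : CyclicPolygon) (F : ℤ → ℤ) (m : ℤ) : Prop where
  st : IStar n F m
  sub : S.V ⊆ V
  mem : ∀ i, e i ∈ S.V ↔ IMem F i
  edge : ∀ u w, u < w → w < u + n → ((e u, e w) ∈ S.E ↔ IEdge F m u w)
  kst : IsKStar S m.toNat

section
variable {V : Finset ℂ} {n : ℤ} {e : ℤ → ℂ}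

lemma arc_ncard (h : Enum V n e) {U : Finset ℂ} (hU : U ⊆ V) {F : ℤ → ℤ}
    (hF : ∀ x, (e x ∈ U → F (x + 1) = F x + 1) ∧ (¬ e x ∈ U → F (x + 1) = F x)) {u w : ℤ} (h1 : u < w) (h2 : w < u + n) :
    (((U : Set ℂ) ∩ arcOO (e u) (e w)).ncard : ℤ) = F w - F (u + 1) := by
  rw [← card_cnt (T := fun x => e x ∈ U) hF (by omega : u + 1 ≤ w)]
  have : (U : Set ℂ) ∩ arcOO (e u) (e w) = e '' ((Finset.Ico (u + 1) w).filter (fun x => e x ∈ U)) := by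
    ext v
    simp only [Set.mem_inter_iff, Finset.mem_coe, arcOO, Set.mem_ofPred_eq, Set.mem_image,
      Finset.mem_filter, Finset.mem_Ico]
    constructor
    · rintro ⟨a1, a2, a3, a4⟩
      obtain ⟨j, b1, b2, rfl⟩ := h.surj v (hU a1) u
      have b3 : u < j := lt_of_le_of_ne b1 (by rintro rfl; exact a2 rfl)
      rw [h.arc u j w b3 b2 h1 h2] at a4
      exact ⟨j, ⟨⟨by omega, a4⟩, a1⟩, rfl⟩
    · rintro ⟨j, ⟨⟨a1, a2⟩, a3⟩, rfl⟩
      refine ⟨a3, ?_, ?_, ?_⟩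
      · intro hc
        have := h.inj u j (by omega) (by omega) hc.symm
        omega
      · intro hc
        have := h.inj j w (by omega) (by omega) hc
        omega
      · rw [h.arc u j w (by omega) (by omega) h1 h2]; exact a2
  rw [this, Set.InjOn.ncard_image, Set.ncard_coe_finset]
  intro i hi j hj hij
  simp only [Finset.coe_filter, Finset.mem_Ico, Set.mem_ofPred_eq] at hi hj
  rcases le_total i j with hl | hl
  · exact h.inj i j hl (by omega) hij
  · exact (h.inj j i hl (by omega) hij.symm).symm

lemma card_period (h : Enum V n e) {U : Finset ℂ} (hU : U ⊆ V) {F : ℤ → ℤ}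
    (hF : ∀ x, (e x ∈ U → F (x + 1) = F x + 1) ∧ (¬ e x ∈ U → F (x + 1) = F x)) (x : ℤ) : F (x + n) = F x + U.card := by
  have hn := h.npos
  have h1 := card_cnt (T := fun x => e x ∈ U) hF (by omega : x ≤ x + n)
  have : U = ((Finset.Ico x (x + n)).filter (fun x => e x ∈ U)).image e := by
    ext v
    simp only [Finset.mem_image, Finset.mem_filter, Finset.mem_Ico]
    constructor
    · intro hv
      obtain ⟨j, b1, b2, rfl⟩ := h.surj v (hU hv) x
      exact ⟨j, ⟨⟨b1, b2⟩, hv⟩, rfl⟩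
    · rintro ⟨j, ⟨_, hj⟩, rfl⟩; exact hj
  have h2 : U.card = ((Finset.Ico x (x + n)).filter (fun x => e x ∈ U)).card := by
    conv_lhs => rw [this]
    apply Finset.card_image_of_injOn
    intro i hi j hj hij
    simp only [Finset.coe_filter, Finset.mem_Ico, Set.mem_ofPred_eq] at hi hj
    rcases le_total i j with hl | hl
    · exact h.inj i j hl (by omega) hij
    · exact (h.inj j i hl (by omega) hij.symm).symm
  rw [h2]; linarith

lemma star_to_int (h : Enum V n e) (S : CyclicPolygon) (hS : S.V ⊆ V) (k : ℕ) (hk : 0 < k)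
    (hst : IsKStar S k) : ∃ F : ℤ → ℤ, StarRep V n e S F k := by
  obtain ⟨F, hF⟩ := exists_cnt (fun i => e i ∈ S.V)
  have hmem : ∀ i, e i ∈ S.V ↔ IMem F i := by
    intro i
    unfold IMem
    constructor
    · exact (hF i).1
    · intro hi
      by_contra hc
      have := (hF i).2 hc
      omega
  have hI : IStar n F k := by
    refine ⟨by exact_mod_cast hk, ?_, ?_⟩
    · intro x
      by_cases hx : e x ∈ S.V
      · exact Or.inr ((hF x).1 hx)
      · exact Or.inl ((hF x).2 hx)
    · intro x; rw [card_period h hS hF, hst.1]; push_cast; ring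
  have hfwd : ∀ u w, u < w → w < u + n → (e u, e w) ∈ S.E → IEdge F k u w := by
    intro u w h1 h2 he
    have hu := (hmem u).1 (S.endmem _ he).1
    refine ⟨hu, (hmem w).1 (S.endmem _ he).2, ?_⟩
    have h3 := hst.2 _ he
    unfold edgeLength at h3
    have h4 := arc_ncard h hS hF h1 h2
    unfold IMem at hu
    simp only at h3
    omega
  refine ⟨F, hI, hS, hmem, fun u w h1 h2 => ⟨hfwd u w h1 h2, ?_⟩, by simpa using hst⟩
  rintro ⟨a1, a2, a3⟩
  obtain ⟨v, hv, _⟩ := S.outdeg _ ((hmem u).2 a1)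
  have hvV := (S.endmem _ hv).2
  obtain ⟨v', hv', _⟩ := S.outdeg _ hvV
  have hne := (S.acw _ _ _ hv hv').1
  obtain ⟨j, b1, b2, rfl⟩ := h.surj v (hS hvV) u
  have b3 : u < j := lt_of_le_of_ne b1 (by rintro rfl; exact hne rfl)
  obtain ⟨_, c2, c3⟩ := hfwd u j b3 b2 hv
  rw [hI.uniq a2 c2 (by omega)]
  exact hv

lemma int_to_star (h : Enum V n e) (hV : ∀ v ∈ V, ‖v‖ = 1) (F : ℤ → ℤ) (m : ℤ) (hI : IStar n F m) :
    ∃ S, StarRep V n e S F m := by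
  have hn := h.npos
  have hp := hI.pos
  have hmemV : ∀ i, e i ∈ V.filter (fun v => ∃ i, e i = v ∧ IMem F i) ↔ IMem F i := by
    intro i
    rw [Finset.mem_filter]
    constructor
    · rintro ⟨_, j, hj, hj'⟩
      obtain ⟨t, rfl⟩ := h.eq_iff hj
      exact (shift_inv (Q := fun u _ => IMem F u) (fun u _ => hI.mem_shift u) t j 0).2 hj'
    · intro hi
      exact ⟨h.mem i, i, rfl, hi⟩
  have hE : ∀ u w, u < w → w < u + n → ((e u, e w) ∈ (V ×ˢ V).filter
      (fun p => ∃ u w, e u = p.1 ∧ e w = p.2 ∧ IEdge F m u w) ↔ IEdge F m u w) := by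
    intro u w h1 h2
    rw [Finset.mem_filter]
    constructor
    · rintro ⟨_, u', w', a1, a2, a3⟩
      obtain ⟨b1, b2⟩ := hI.edge_lt a3
      obtain ⟨t, rfl, rfl⟩ := h.eq_pair a1 a2 b1 b2 h1 h2
      exact (shift_inv (Q := fun u w => IEdge F m u w) hI.edge_shift t u' w').2 a3
    · intro hh
      exact ⟨Finset.mk_mem_product (h.mem _) (h.mem _), u, w, rfl, rfl, hh⟩
  have hEdest : ∀ p ∈ (V ×ˢ V).filter
      (fun p => ∃ u w, e u = p.1 ∧ e w = p.2 ∧ IEdge F m u w), ∃ u w, p = (e u, e w) ∧ IEdge F m u w ∧ u < w ∧ w < u + n := by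
    intro p hp
    rw [Finset.mem_filter] at hp
    obtain ⟨_, u, w, a1, a2, a3⟩ := hp
    exact ⟨u, w, by rw [a1, a2], a3, hI.edge_lt a3⟩
  let S : CyclicPolygon := {
    V := V.filter (fun v => ∃ i, e i = v ∧ IMem F i)
    E := (V ×ˢ V).filter (fun p => ∃ u w, e u = p.1 ∧ e w = p.2 ∧ IEdge F m u w)
    nonempty := by
      obtain ⟨x, _, hx⟩ := hI.hit 0
      exact ⟨e x, (hmemV x).2 hx⟩
    onCircle := fun v hv => hV v (Finset.mem_filter.1 hv).1
    endmem := by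
      intro p hp
      obtain ⟨u, w, rfl, a1, _⟩ := hEdest p hp
      exact ⟨(hmemV u).2 a1.1, (hmemV w).2 a1.2.1⟩
    outdeg := by
      intro v hv
      obtain ⟨hv, u, rfl, hu⟩ := Finset.mem_filter.1 hv
      obtain ⟨w, hw, hw'⟩ := hI.hit (F u + m)
      have he : IEdge F m u w := ⟨hu, hw', hw⟩
      obtain ⟨l1, l2⟩ := hI.edge_lt he
      refine ⟨e w, (hE u w l1 l2).2 he, ?_⟩
      intro y hy
      obtain ⟨u', w', h1, h2, h3, h4⟩ := hEdest _ hy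
      rw [Prod.mk.injEq] at h1
      obtain ⟨h1, rfl⟩ := h1
      obtain ⟨j, j1, j2, j3⟩ := h.surj (e w') (h.mem _) u
      rw [h1, ← j3] at hy
      rw [← j3]
      have hne : u ≠ j := by
        rintro rfl
        have := h.inj u' w' h3.le h4 (by rw [← j3, h1])
        omega
      rw [← h1] at hy
      have := (hE u j (by omega) j2).1 hy
      rw [hI.uniq this.2.1 he.2.1 (by rw [this.2.2, he.2.2])]
    indeg := by
      intro v hv
      obtain ⟨hv, u, rfl, hu⟩ := Finset.mem_filter.1 hv
      obtain ⟨w, hw, hw'⟩ := hI.hit (F u - m)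
      have he : IEdge F m w u := ⟨hw', hu, by omega⟩
      obtain ⟨l1, l2⟩ := hI.edge_lt he
      refine ⟨e w, (hE w u l1 l2).2 he, ?_⟩
      intro y hy
      obtain ⟨u', w', h1, h2, h3, h4⟩ := hEdest _ hy
      rw [Prod.mk.injEq] at h1
      obtain ⟨rfl, h1⟩ := h1
      obtain ⟨j, j1, j2, j3⟩ := h.surj (e u') (h.mem _) (u - n)
      rw [← j3] at hy
      rw [← j3]
      have hne : u - n ≠ j := by
        rintro rfl
        have h5 := h.per (u - n)
        rw [show u - n + n = u by ring] at h5
        have := h.inj u' w' h3.le h4 (by rw [← h1, h5, j3])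
        omega
      have := (hE j u (by omega) (by omega)).1 hy
      rw [hI.uniq this.1 he.1 (by have := this.2.2; have := he.2.2; omega)]
    acw := by
      intro u v w huv hvw
      obtain ⟨i, j, h1, h2, h3, h4⟩ := hEdest _ huv
      rw [Prod.mk.injEq] at h1
      obtain ⟨rfl, rfl⟩ := h1
      obtain ⟨j', l', g1, g2, g3, g4⟩ := hEdest _ hvw
      rw [Prod.mk.injEq] at g1
      obtain ⟨g1, rfl⟩ := g1
      obtain ⟨l, l1, l2⟩ := hI.hit (F j + m)
      have g : IEdge F m j l := ⟨h2.2.1, l2, l1⟩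
      obtain ⟨g5, g6⟩ := hI.edge_lt g
      have hll : e l = e l' := by
        obtain ⟨t, rfl⟩ := h.eq_iff g1
        have g2' : IEdge F m (j + t * n) (l' - t * n + t * n) := by rwa [sub_add_cancel]
        rw [shift_inv (Q := fun u w => IEdge F m u w) hI.edge_shift t] at g2'
        rw [hI.uniq l2 g2'.2.1 (by rw [l1, g2'.2.2]), ← h.per_int t, sub_add_cancel]
      rw [← hll]
      have k1 := h2.2.2
      have k2 := hI.per i
      have k3 : l < i + n := hI.lt_of (by omega)
      refine ⟨?_, ?_, ?_, ?_⟩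
      · intro hc; have := h.inj _ _ h3.le h4 hc; omega
      · intro hc; have := h.inj _ _ g5.le g6 hc; omega
      · intro hc; have := h.inj _ _ (h3.trans g5).le k3 hc; omega
      · rw [h.arc i j l h3 h4 (h3.trans g5) k3]; exact g5 }
  have hF : ∀ x, (e x ∈ S.V → F (x + 1) = F x + 1) ∧ (¬ e x ∈ S.V → F (x + 1) = F x) := by
    intro x
    constructor
    · exact (hmemV x).1
    · intro hx
      rcases hI.step x with h | h
      · omega
      · exact absurd ((hmemV x).2 h) hx
  have hsub : S.V ⊆ V := Finset.filter_subset _ _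
  refine ⟨S, hI, hsub, hmemV, hE, ?_, ?_⟩
  · have h1 := card_period h hsub hF 0
    clear_value S
    have h2 := hI.per 0
    omega
  · intro p hp
    obtain ⟨u, w, rfl, a1, a2, a3⟩ := hEdest p hp
    unfold edgeLength
    have h1 := arc_ncard h hsub hF a2 a3
    clear_value S
    have h2 := a1.2.2
    have h3 := a1.1
    unfold IMem at h3
    simp only
    omega

end


/-- Integer model of a star decomposition. -/
structure IDecomp {ι : Type} (n k : ℤ) (F : ι → ℤ → ℤ) (m : ι → ℤ) (Dd : ℤ → ℤ → Prop) : Prop where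
  st : ∀ S, IStar n (F S) (m S)
  kpos : 1 ≤ k
  hnk : 2 * k + 1 ≤ n
  dsw : ∀ u v, Dd u v → Dd v (u + n)
  dper : ∀ u v, Dd u (v + n) → Dd u v
  dsym : ∀ u v, Dd u v → Dd v u
  dlen : ∀ u v, Dd u v → u < v → v < u + n → u + k < v ∧ v < u + n - k
  edge : ∀ S u w, IEdge (F S) (m S) u w → w = u + k ∨ Dd u w
  cov : ∀ u, ∃ S, IEdge (F S) (m S) u (u + k)
  cov' : ∀ u w, Dd u w → u < w → w < u + n → ∃ S, IEdge (F S) (m S) u w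
  disj : ∀ S S' u w, IEdge (F S) (m S) u w → IEdge (F S') (m S') u w → S = S'
  nos : ∀ S u x, ISec (F S) (m S) u (x - 1) → ISec (F S) (m S) u x → ¬ Dd u x

/-- Linkable pair of two stars, lifted to the integers. -/
def ILink (F : ℤ → ℤ) (m : ℤ) (F' : ℤ → ℤ) (m' u v : ℤ) : Prop :=
  IMem F u ∧ F v = F u + m + 1 ∧ F (v + 1) = F u + m + 1 ∧
  IMem F' v ∧ F' u = F' v - m' ∧ F' (u + 1) = F' v - m'

namespace IDecomp
variable {ι : Type} {n k : ℤ} {F : ι → ℤ → ℤ} {m : ι → ℤ} {Dd : ℤ → ℤ → Prop}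

/-- The two sides of the angle containing a sector. -/
lemma sides (h : IDecomp n k F m Dd) {S : ι} {u x : ℤ} (hs : ISec (F S) (m S) u x) :
    ∃ y w, IEdge (F S) (m S) u y ∧ IEdge (F S) (m S) w (u + n) ∧ y ≤ x ∧ x < w ∧ u + k ≤ y ∧
      w ≤ u + n - k ∧ F S w = F S u + m S + 1 := by
  have hst := h.st S
  obtain ⟨h1, h2⟩ := hs
  obtain ⟨y, y1, y2⟩ := hst.hit (F S u + m S)
  obtain ⟨w, w1, w2⟩ := hst.hit (F S u + m S + 1)
  have hp := hst.per u
  have ey : IEdge (F S) (m S) u y := ⟨h1, y2, y1⟩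
  have ew : IEdge (F S) (m S) w (u + n) := ⟨w2, (hst.mem_shift u).2 h1, by omega⟩
  have l1 := hst.edge_lt ey
  have l2 := hst.edge_lt ew
  have a1 : y < x + 1 := hst.lt_of (by omega)
  have a2 : x + 1 < w + 1 := hst.lt_of (by unfold IMem at w2; omega)
  refine ⟨y, w, ey, ew, by omega, by omega, ?_, ?_, w1⟩
  · rcases h.edge _ _ _ ey with hh | hh
    · omega
    · have := h.dlen _ _ hh l1.1 l1.2; omega
  · rcases h.edge _ _ _ ew with hh | hh
    · omega
    · have := h.dlen _ _ hh l2.1 l2.2; omega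

lemma sec_of (h : IDecomp n k F m Dd) {S : ι} {u x y w : ℤ} (ey : IEdge (F S) (m S) u y)
    (hw : F S w = F S u + m S + 1) (h1 : y ≤ x) (h2 : x < w) : ISec (F S) (m S) u x := by
  have hst := h.st S
  refine ⟨ey.1, ?_⟩
  have a := hst.mono (show y + 1 ≤ x + 1 by omega)
  have b := hst.mono (show x + 1 ≤ w by omega)
  have c := ey.2.1
  have d := ey.2.2
  unfold IMem at c
  omega

lemma sec_uniq (h : IDecomp n k F m Dd) {S S' : ι} {u x : ℤ} (hs : ISec (F S) (m S) u x)
    (hs' : ISec (F S') (m S') u x) : S = S' := by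
  have key : ∀ S S' : ι, ISec (F S) (m S) u x → ∀ y y', IEdge (F S) (m S) u y → y ≤ x →
      IEdge (F S') (m S') u y' → y' ≤ x → u + k ≤ y → ¬ y < y' := by
    intro S S' hs y y' e1 l1 e2 l2 l3 hlt
    obtain ⟨_, w, _, _, _, hw, _, _, hw'⟩ := h.sides hs
    rcases h.edge _ _ _ e2 with hh | hh
    · omega
    · exact h.nos S u y' (h.sec_of e1 hw' (by omega) (by omega)) (h.sec_of e1 hw' (by omega) (by omega)) hh
  obtain ⟨y, w, a1, a2, a3, a4, a5, a6, a7⟩ := h.sides hs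
  obtain ⟨y', w', b1, b2, b3, b4, b5, b6, b7⟩ := h.sides hs'
  have c1 := key S S' hs y y' a1 a3 b1 b3 a5
  have c2 := key S' S hs' y' y b1 b3 a1 a3 b5
  have : y = y' := by omega
  subst this
  exact h.disj _ _ _ _ a1 b1

lemma sec_exists (h : IDecomp n k F m Dd) {u x : ℤ} (h1 : u + k ≤ x) (h2 : x < u + n - k) :
    ∃ S, ISec (F S) (m S) u x := by
  obtain ⟨y, ⟨hy, S, hS⟩, hmax⟩ := Int.exists_greatest_of_bdd
    (P := fun y => y ≤ x ∧ ∃ S, IEdge (F S) (m S) u y) ⟨x, fun z hz => hz.1⟩ ⟨u + k, h1, h.cov u⟩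
  have hst := h.st S
  obtain ⟨w, w1, w2⟩ := hst.hit (F S u + m S + 1)
  have hp := hst.per u
  have hpos := hst.pos
  have ew : IEdge (F S) (m S) w (u + n) := ⟨w2, (hst.mem_shift u).2 hS.1, by omega⟩
  have l2 := hst.edge_lt ew
  have l3 : u < w := hst.lt_of (by omega)
  have l4 : y < w := hst.lt_of (by have := hS.2.2; omega)
  refine ⟨S, h.sec_of hS w1 hy ?_⟩
  by_contra hc
  rcases h.edge _ _ _ ew with hh | hh
  · omega
  · obtain ⟨S', hS'⟩ := h.cov' u w (h.dsym _ _ (h.dper _ _ hh)) l3 (by omega)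
    have := hmax w ⟨by omega, S', hS'⟩
    omega

lemma pivot (h : IDecomp n k F m Dd) (S : ι) (x : ℤ) : ∃ a, ISec (F S) (m S) a x := by
  obtain ⟨a, a1, a2⟩ := (h.st S).hit (F S (x + 1) - m S - 1)
  exact ⟨a, a2, by omega⟩

lemma card_eq [Fintype ι] (h : IDecomp n k F m Dd) : (Fintype.card ι : ℤ) = n - 2 * k := by
  choose p hp using fun S => h.pivot S 0
  have hb := h.hnk
  have : (Finset.univ : Finset ι).card = (Finset.Ioc (-n + k) (-k)).card := by
    apply Finset.card_bij (fun S _ => p S)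
    · intro S _
      obtain ⟨y, w, a1, a2, a3, a4, a5, a6, a7⟩ := h.sides (hp S)
      rw [Finset.mem_Ioc]; omega
    · intro S _ S' _ he
      have h1 := hp S
      rw [he] at h1
      exact h.sec_uniq h1 (hp S')
    · intro a ha
      rw [Finset.mem_Ioc] at ha
      obtain ⟨S, hS⟩ := h.sec_exists (u := a) (x := 0) (by omega) (by omega)
      refine ⟨S, Finset.mem_univ _, ?_⟩
      have h1 := hp S
      exact (h.st S).uniq h1.1 hS.1 (by have := h1.2; have := hS.2; omega)
  rw [← Finset.card_univ, this, Int.card_Ioc]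
  omega

lemma not_always (h : IDecomp n k F m Dd) (p : ι → ℤ → ℤ) (hp : ∀ S x, ISec (F S) (m S) (p S x) x)
    (S S' : ι) : ¬ ∀ x, p S x < p S' x := by
  intro hall
  have hs := h.st S
  have hs' := h.st S'
  obtain ⟨u, u1, u2⟩ := hs.hit 0
  obtain ⟨w, w1, w2⟩ := hs.hit (F S u + m S + 1)
  have e1 : p S (u + n) = w := by
    have h1 := hp S (u + n)
    refine hs.uniq h1.1 w2 ?_
    have h2 := h1.2
    have h3 := hs.per (u + 1)
    rw [show u + n + 1 = u + 1 + n by ring] at h2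
    unfold IMem at u2
    omega
  have e2 : p S (w - 1) = u := by
    have h1 := hp S (w - 1)
    refine hs.uniq h1.1 u2 ?_
    have h2 := h1.2
    rw [sub_add_cancel] at h2
    omega
  have a1 := hall (u + n)
  have a2 := hall (w - 1)
  rw [e1] at a1
  rw [e2] at a2
  have b1 := (hp S' (u + n)).2
  have b2 := (hp S' (w - 1)).2
  rw [sub_add_cancel] at b2
  rw [show u + n + 1 = u + 1 + n by ring, hs'.per] at b1
  have c1 := hs'.mono a1.le
  have c2 := hs'.mono (show u + 1 ≤ p S' (w - 1) by omega)
  have c3 := (hp S' (w - 1)).1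
  unfold IMem at c3
  omega

lemma link_exists (h : IDecomp n k F m Dd) {S S' : ι} (hne : S ≠ S') :
    ∃ u v, ILink (F S) (m S) (F S') (m S') u v := by
  choose p hp using h.pivot
  have hs := h.st S
  have hs' := h.st S'
  have hn := hs.npos
  have hpne : ∀ x, p S x ≠ p S' x := by
    intro x he
    have h1 := hp S x
    rw [he] at h1
    exact hne (h.sec_uniq h1 (hp S' x))
  have hmono : ∀ x, p S' x ≤ p S' (x + 1) := by
    intro x
    have h1 := hp S' x
    have h2 := hp S' (x + 1)
    have h3 := hs'.mono (show x + 1 ≤ x + 1 + 1 by omega)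
    have := @IStar.lt_of _ _ _ hs' (p S' x) (p S' (x + 1) + 1) (by
      have := h1.2; have := h2.2; have := h2.1; unfold IMem at this; omega)
    omega
  have hsh : ∀ T x, p T (x + n) = p T x + n := by
    intro T x
    have h1 := (h.st T).sec_shift (p T x) x |>.2 (hp T x)
    have h2 := hp T (x + n)
    exact (h.st T).uniq h2.1 h1.1 (by have := h1.2; have := h2.2; omega)
  have hshn : ∀ T x (t : ℕ), p T (x + t * n) = p T x + t * n := by
    intro T x t
    induction t with
    | zero => simp
    | succ t ih =>
      push_cast
      rw [show x + ((t : ℤ) + 1) * n = x + t * n + n by ring, hsh, ih]; ring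
  obtain ⟨x, hx1, hx2⟩ : ∃ x, p S x < p S' x ∧ p S' (x + 1) < p S (x + 1) := by
    by_contra hc
    push Not at hc
    have i1 := h.not_always p hp S S'
    have i2 := h.not_always p hp S' S
    push Not at i1 i2
    obtain ⟨x0, hx0⟩ := i1
    obtain ⟨x1, hx1⟩ := i2
    have hx1' : p S x1 < p S' x1 := lt_of_le_of_ne hx1 (hpne x1)
    have hall : ∀ x, x1 ≤ x → p S x < p S' x := by
      intro x hx
      induction x, hx using Int.leInduction with
      | base => exact hx1'
      | succ x hx ih => exact lt_of_le_of_ne (hc x ih) (hpne _)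
    have := hall (x0 + ((x1 - x0).toNat : ℕ) * n) (by
      have : x1 - x0 ≤ ((x1 - x0).toNat : ℤ) := Int.self_le_toNat _
      have h0 : (0:ℤ) ≤ ((x1 - x0).toNat : ℤ) := by positivity
      nlinarith)
    rw [hshn, hshn] at this
    omega
  have hv := hmono x
  obtain ⟨A1, A2⟩ := hp S x
  obtain ⟨B1, B2⟩ := hp S (x + 1)
  obtain ⟨C1, C2⟩ := hp S' x
  obtain ⟨E1, E2⟩ := hp S' (x + 1)
  unfold IMem at A1 B1
  set a := p S x
  set b := p S (x + 1)
  set v := p S' x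
  set v1 := p S' (x + 1)
  have s1 := hs.step (x + 1)
  have s2 := hs.mono (show a + 1 ≤ v by omega)
  have s3 := hs.mono (show v ≤ v + 1 by omega)
  have s4 := hs.mono (show v + 1 ≤ b by omega)
  have q1 := hs.per (x + 1 - n)
  have q2 := hs'.per (x + 1 - n)
  have q3 := hs.per (x + 1 + 1 - n)
  have q4 := hs'.per (x + 1 + 1 - n)
  rw [sub_add_cancel] at q1 q2 q3 q4
  rcases hs'.step (x + 1) with s5 | s5
  · refine ⟨x + 1 - n, v, ?_, by omega, by omega, C1, by omega, ?_⟩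
    · unfold IMem
      rw [show x + 1 - n + 1 = x + 1 + 1 - n by ring]; omega
    · rw [show x + 1 - n + 1 = x + 1 + 1 - n by ring]; omega
  · exfalso
    apply hne
    unfold IMem at C1
    apply h.sec_uniq (u := x + 1) (x := v + n)
    · refine ⟨?_, ?_⟩
      · unfold IMem; omega
      · rw [show v + n + 1 = v + 1 + n by ring, hs.per]; omega
    · refine ⟨s5, ?_⟩
      rw [show v + n + 1 = v + 1 + n by ring, hs'.per]; omega

lemma link_of_notMem (h : IDecomp n k F m Dd) {S : ι} {v : ℤ} (hv : ¬ IMem (F S) v) :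
    ∃ S' u, ILink (F S) (m S) (F S') (m S') u v := by
  have hs := h.st S
  have hv' : F S (v + 1) = F S v := by
    rcases hs.step v with h | h
    · exact h
    · exact absurd h hv
  obtain ⟨u, hu⟩ := h.pivot S v
  have hu0 : ISec (F S) (m S) u (v - 1) := ⟨hu.1, by rw [sub_add_cancel]; have := hu.2; omega⟩
  have hnd := h.nos S u v hu0 hu
  obtain ⟨y, w, a1, a2, a3, a4, a5, a6, a7⟩ := h.sides hu
  obtain ⟨y', w', b1, b2, b3, b4, b5, b6, b7⟩ := h.sides hu0
  obtain ⟨S', hS'⟩ := h.sec_exists (u := v) (x := u + n) (by omega) (by omega)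
  have hs' := h.st S'
  have hu2 := hu.2
  have q1 := hs'.per u
  have q2 := hs'.per (u + 1)
  have hS2 := hS'.2
  rw [show u + n + 1 = u + 1 + n by ring] at hS2
  refine ⟨S', u, hu.1, by omega, by omega, hS'.1, ?_, by omega⟩
  rcases hs'.step u with hh | hh
  · omega
  · exfalso
    have he : IEdge (F S') (m S') v (u + n) := ⟨hS'.1, (hs'.mem_shift u).2 hh, by omega⟩
    rcases h.edge _ _ _ he with hd | hd
    · omega
    · exact hnd (h.dsym _ _ (h.dper _ _ hd))

lemma link_uniq (h : IDecomp n k F m Dd) {S S' S'' : ι} {u u' v : ℤ}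
    (h1 : ILink (F S) (m S) (F S') (m S') u v) (h2 : ILink (F S) (m S) (F S'') (m S'') u' v) :
    S' = S'' := by
  obtain ⟨a1, a2, a3, a4, a5, a6⟩ := h1
  obtain ⟨b1, b2, b3, b4, b5, b6⟩ := h2
  have := (h.st S).uniq a1 b1 (by omega)
  subst this
  apply h.sec_uniq (u := v) (x := u + n)
  · refine ⟨a4, ?_⟩
    rw [show u + n + 1 = u + 1 + n by ring, (h.st S').per]; omega
  · refine ⟨b4, ?_⟩
    rw [show u + n + 1 = u + 1 + n by ring, (h.st S'').per]; omega

lemma link_shift (h : IDecomp n k F m Dd) {S S' : ι} (u v : ℤ) :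
    ILink (F S) (m S) (F S') (m S') (u + n) (v + n) ↔ ILink (F S) (m S) (F S') (m S') u v := by
  unfold ILink
  rw [(h.st S).mem_shift, (h.st S').mem_shift, show v + n + 1 = v + 1 + n by ring,
    show u + n + 1 = u + 1 + n by ring, (h.st S).per, (h.st S').per, (h.st S).per, (h.st S').per, (h.st S).per, (h.st S').per]
  constructor
  · rintro ⟨a1, a2, a3, a4, a5, a6⟩
    exact ⟨a1, by omega, by omega, a4, by omega, by omega⟩
  · rintro ⟨a1, a2, a3, a4, a5, a6⟩
    exact ⟨a1, by omega, by omega, a4, by omega, by omega⟩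

theorem main [Fintype ι] (h : IDecomp n k F m Dd) (S : ι) :
    m S = k ∨ ∃ S' u v u' v', S ≠ S' ∧ ILink (F S) (m S) (F S') (m S') u v ∧
      ILink (F S) (m S) (F S') (m S') u' v' ∧ v < v' ∧ v' < v + n := by
  have hs := h.st S
  have hn := hs.npos
  set U := (Finset.Ico 0 n).filter (fun v => ¬ IMem (F S) v) with hU
  have hUc : (U.card : ℤ) = n - (2 * m S + 1) := by
    have h1 := card_cnt (T := fun v => IMem (F S) v) (F := F S) (fun x => ⟨fun hx => hx, fun hx => by
      rcases hs.step x with h | h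
      · exact h
      · exact absurd h hx⟩) (i := 0) (j := n) hn.le
    have h2 := Finset.card_filter_add_card_filter_not (s := Finset.Ico 0 n) (fun v => IMem (F S) v)
    have h3 := hs.per 0
    rw [zero_add] at h3
    rw [Int.card_Ico] at h2
    rw [← hU] at h2
    omega
  have hOc : ((Finset.univ.erase S).card : ℤ) = n - 2 * k - 1 := by
    have h1 := h.card_eq
    have h2 := Finset.card_erase_add_one (Finset.mem_univ S)
    rw [Finset.card_univ] at h2
    omega
  have hle : m S ≤ k := by
    have hl : ∀ S', S ≠ S' → ∃ v, v ∈ U ∧ ∃ u, ILink (F S) (m S) (F S') (m S') u v := by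
      intro S' hne
      obtain ⟨u, v, hl⟩ := h.link_exists hne
      have h1 := Int.emod_add_mul_ediv v n
      have h2 := (shift_inv (Q := fun u v => ILink (F S) (m S) (F S') (m S') u v) h.link_shift (-(v / n)) u v).2 hl
      have h3 : v + -(v / n) * n = v % n := by linarith
      refine ⟨v % n, ?_, u + -(v / n) * n, by rwa [h3] at h2⟩
      rw [h3] at h2
      rw [hU, Finset.mem_filter, Finset.mem_Ico]
      refine ⟨⟨Int.emod_nonneg _ hn.ne', Int.emod_lt_of_pos _ hn⟩, ?_⟩
      obtain ⟨a1, a2, a3, _⟩ := h2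
      unfold IMem; omega
    choose! g hg using hl
    have := Finset.card_le_card_of_injOn (s := Finset.univ.erase S) (t := U) g
      (fun S' hS' => (hg S' (Finset.ne_of_mem_erase hS').symm).1) (by
        intro S' hS' S'' hS'' he
        obtain ⟨u, hu⟩ := (hg S' (Finset.ne_of_mem_erase hS').symm).2
        obtain ⟨u', hu'⟩ := (hg S'' (Finset.ne_of_mem_erase hS'').symm).2
        rw [← he] at hu'
        exact h.link_uniq hu hu')
    omega
  by_cases hk : m S = k
  · exact Or.inl hk
  right
  have hl : ∀ v, v ∈ U → ∃ S', ∃ u, ILink (F S) (m S) (F S') (m S') u v :=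
    fun v hv => h.link_of_notMem (Finset.mem_filter.1 hv).2
  have hne : ∀ v S' u, ILink (F S) (m S) (F S') (m S') u v → S ≠ S' := by
    rintro v S' u ⟨_, a1, a2, a3, _⟩ rfl
    unfold IMem at a3; omega
  haveI : Nonempty ι := ⟨S⟩
  choose! g hg using hl
  obtain ⟨v, hv, v', hv', hvv, he⟩ := Finset.exists_ne_map_eq_of_card_lt_of_maps_to
    (s := U) (t := Finset.univ.erase S) (f := g) (by omega) (by
      intro v hv
      obtain ⟨u, hu⟩ := hg v hv
      exact Finset.mem_coe.2 (Finset.mem_erase.2 ⟨(hne _ _ _ hu).symm, Finset.mem_univ _⟩))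
  obtain ⟨u, hu⟩ := hg v hv
  obtain ⟨u', hu'⟩ := hg v' hv'
  rw [← he] at hu'
  have i1 := Finset.mem_Ico.1 (Finset.mem_filter.1 hv).1
  have i2 := Finset.mem_Ico.1 (Finset.mem_filter.1 hv').1
  rcases lt_or_gt_of_ne hvv with hlt | hlt
  · exact ⟨g v, u, v, u', v', hne _ _ _ hu, hu, hu', hlt, by omega⟩
  · exact ⟨g v, u', v', u, v, hne _ _ _ hu, hu', hu, hlt, by omega⟩

/-- Normal form for two links. -/
theorem normal (h : IDecomp n k F m Dd) {S S' : ι} {a b c d : ℤ}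
    (h1 : ILink (F S) (m S) (F S') (m S') a b) (h2 : ILink (F S) (m S) (F S') (m S') c d)
    (hbd : b < d) (hdb : d < b + n) :
    ∃ a b c d, ILink (F S) (m S) (F S') (m S') a b ∧ ILink (F S) (m S) (F S') (m S') c d ∧
      a < c ∧ c < b ∧ b < d ∧ d < a + n := by
  have hs := h.st S
  have hs' := h.st S'
  obtain ⟨a1, a2, a3, a4, a5, a6⟩ := id h1
  obtain ⟨b1, b2, b3, b4, b5, b6⟩ := id h2
  have pa := hs.per a
  have pb := hs.per b
  have pa1 := hs.per (a + 1)
  rw [show a + 1 + n = a + n + 1 by ring] at pa1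
  have hpos := hs.pos
  unfold IMem at a1 a4 b1 b4
  have hac : a < c := by
    apply hs'.lt_of
    have := hs'.mono (show b + 1 ≤ d by omega)
    omega
  rcases lt_trichotomy c b with hcb | hcb | hcb
  · refine ⟨a, b, c, d, h1, h2, hac, hcb, hbd, ?_⟩
    have := hs.mono (show c + 1 ≤ b by omega)
    apply hs.lt_of |> fun f => (f : F S d < F S (a + n + 1) → _) |> fun g => ?_
    have hh := g (by omega)
    rcases eq_or_lt_of_le (show d ≤ a + n by omega) with e | e
    · subst e; omega
    · exact e
  · subst hcb; omega
  · have l1 := hs.mono (show b + 1 ≤ c by omega)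
    have l2 : a + n < d := hs.lt_of (by omega)
    have l3 : c < a + n := by
      have := hs.mono (show d ≤ b + n by omega)
      apply hs.lt_of |> fun f => (f : F S c < F S (a + n + 1) → _) |> fun g => ?_
      have hh := g (by omega)
      rcases eq_or_lt_of_le (show c ≤ a + n by omega) with e | e
      · subst e
        have q := hs'.mono (show d ≤ b + n by omega)
        have q0 := hs'.per b
        have q1 := hs'.per a
        have q2 := hs'.mono (show d + 1 ≤ b + n by omega)
        omega
      · exact e
    refine ⟨c - n, d - n, a, b, ?_, h1, by omega, by omega, by omega, by omega⟩
    have := h.link_shift (S := S) (S' := S') (c - n) (d - n)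
    rw [sub_add_cancel, sub_add_cancel] at this
    exact this.1 h2

end IDecomp


/-- Splice two stars along two crossing links: the counting function. -/
lemma splice {n m1 m2 a b c d : ℤ} {F1 F2 : ℤ → ℤ} (s1 : IStar n F1 m1) (s2 : IStar n F2 m2)
    (hl : ILink F1 m1 F2 m2 a b) (hl' : ILink F1 m1 F2 m2 c d)
    (h1 : a < c) (h2 : c < b) (h3 : b < d) (h4 : d < a + n) :
    ∃ G M, IStar n G M ∧ M = F1 c - F1 a + F2 b - F2 c + 1 ∧
      (∀ x, a ≤ x → x ≤ c + 1 → G x = F1 x - F1 a) ∧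
      (∀ x, c + 1 ≤ x → x ≤ b + 1 → G x = F1 c + 1 - F1 a + F2 x - F2 c) ∧
      (∀ x, b + 1 ≤ x → x ≤ d → G x = F1 c + 1 - F1 a + F2 b + 1 - F2 c + F1 x - F1 b) ∧
      (∀ x, d ≤ x → x ≤ a + n → G x = F1 c + 1 - F1 a + F2 b + 1 - F2 c + F1 d - F1 b + F2 x - F2 d) := by
  obtain ⟨l1, l2, l3, l4, l5, l6⟩ := hl
  obtain ⟨k1, k2, k3, k4, k5, k6⟩ := hl'
  unfold IMem at l1 l4 k1 k4
  have p1 := s1.per a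
  have p2 := s2.per a
  set M := F1 c - F1 a + F2 b - F2 c + 1 with hM
  let g : ℤ → ℤ := fun x => if x ≤ c then F1 x - F1 a else
    if x ≤ b then F1 c + 1 - F1 a + F2 x - F2 c else
    if x < d then F1 c + 1 - F1 a + F2 b + 1 - F2 c + F1 x - F1 b else
    F1 c + 1 - F1 a + F2 b + 1 - F2 c + F1 d - F1 b + F2 x - F2 d
  have gs : ∀ x, g (x + 1) = g x ∨ g (x + 1) = g x + 1 := by
    intro x
    have q1 := s1.step x
    have q2 := s2.step x
    have q3 : x + 1 = d → F1 (x + 1) = F1 d ∧ F2 (x + 1) = F2 d := by rintro rfl; simp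
    simp only [g]
    by_cases e1 : x = c
    · subst e1; split_ifs <;> omega
    by_cases e2 : x = b
    · subst e2; split_ifs <;> omega
    by_cases e3 : x + 1 = d
    · rw [e3] at q1 q2 ⊢; split_ifs <;> omega
    split_ifs <;> omega
  have ga : g a = 0 := by simp only [g]; split_ifs <;> omega
  have gan : g (a + n) = 2 * M + 1 := by simp only [g]; split_ifs <;> omega
  have hn : 0 < n := by omega
  let G : ℤ → ℤ := fun x => (x - a) / n * (2 * M + 1) + g (a + (x - a) % n)
  have hG : ∀ x, a ≤ x → x ≤ a + n → G x = g x := by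
    intro x y1 y2
    simp only [G]
    rcases eq_or_lt_of_le y2 with y3 | y3
    · subst y3
      rw [add_sub_cancel_left, Int.ediv_self (by omega), Int.emod_self, add_zero, ga, gan]; ring
    · rw [Int.ediv_eq_zero_of_lt (by omega) (by omega), Int.emod_eq_of_lt (by omega) (by omega)]
      simp
  have hper : ∀ x, G (x + n) = G x + 2 * M + 1 := by
    intro x
    simp only [G]
    rw [show x + n - a = x - a + n by ring, Int.add_emod_right, Int.add_ediv_of_dvd_right dvd_rfl,
      Int.ediv_self (by omega)]
    ring
  have hstep : ∀ x, G (x + 1) = G x ∨ G (x + 1) = G x + 1 := by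
    intro x
    have w1 := Int.emod_nonneg (x - a) (show n ≠ 0 by omega)
    have w2 := Int.emod_lt_of_pos (x - a) hn
    have key : ∀ t r : ℤ, G (r + t * n) = G r + t * (2 * M + 1) := by
      intro t r
      simp only [G]
      rw [show r + t * n - a = r - a + t * n by ring, Int.add_mul_emod_self_right, Int.add_mul_ediv_right _ _ (by omega)]
      ring
    have w3 := Int.emod_add_mul_ediv (x - a) n
    set r := (x - a) % n
    set t := (x - a) / n
    have e1 : x = a + r + t * n := by linarith
    have e2 : x + 1 = (a + r + 1) + t * n := by linarith
    rw [e2, key, e1, key, hG _ (by omega) (by omega), hG _ (by omega) (by omega)]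
    rcases gs (a + r) with h | h <;> rw [h] <;> simp <;> ring_nf <;> tauto
  have q3 : b + 1 = d → F1 (b + 1) = F1 d ∧ F2 (b + 1) = F2 d := by rintro rfl; simp
  have c1 := s1.mono h1.le
  have c2 := s2.mono h2.le
  have c3 := s2.mono (show c + 1 ≤ b by omega)
  have c4 := s1.mono (show a + 1 ≤ c by omega)
  refine ⟨G, M, ⟨by omega, hstep, hper⟩, rfl, ?_, ?_, ?_, ?_⟩
  · intro x y1 y2
    rw [hG x (by omega) (by omega)]
    rcases eq_or_lt_of_le y2 with y3 | y3
    · subst y3; simp only [g]; split_ifs <;> omega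
    · simp only [g]; split_ifs <;> omega
  · intro x y1 y2
    rw [hG x (by omega) (by omega)]
    rcases eq_or_lt_of_le y2 with y3 | y3
    · subst y3; simp only [g]; split_ifs <;> omega
    · simp only [g]; split_ifs <;> omega
  · intro x y1 y2
    rw [hG x (by omega) (by omega)]
    rcases eq_or_lt_of_le y2 with y3 | y3
    · subst y3; simp only [g]; split_ifs <;> omega
    · simp only [g]; split_ifs <;> omega
  · intro x y1 y2
    rw [hG x (by omega) (by omega)]
    simp only [g]; split_ifs <;> omega

set_option maxHeartbeats 1600000 in
/-- Sector rule for the spliced star, in a fundamental window. -/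
lemma splice_sec {n m1 m2 a b c d : ℤ} {F1 F2 : ℤ → ℤ} (s1 : IStar n F1 m1) (s2 : IStar n F2 m2)
    (hl : ILink F1 m1 F2 m2 a b) (hl' : ILink F1 m1 F2 m2 c d)
    (h1 : a < c) (h2 : c < b) (h3 : b < d) (h4 : d < a + n) :
    ∃ G M, IStar n G M ∧ ∀ u x, a ≤ u → u < a + n → (ISec G M u x ↔
      (((u ≤ c ∧ b ≤ x ∧ x < d) ∨ (b ≤ u ∧ u ≤ d ∧ a + n ≤ x ∧ x < c + n)) ∧ ISec F1 m1 u x) ∨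
      (((u = a ∧ c ≤ x ∧ x < b) ∨ (c ≤ u ∧ u ≤ b ∧ d ≤ x ∧ x < a + n) ∨ (d ≤ u ∧ c + n ≤ x ∧ x < b + n)) ∧
        ISec F2 m2 u x)) := by
  obtain ⟨G, M, hS, hM, g1, g2, g3, g4⟩ := splice s1 s2 hl hl' h1 h2 h3 h4
  refine ⟨G, M, hS, ?_⟩
  obtain ⟨l1, l2, l3, l4, l5, l6⟩ := hl
  obtain ⟨k1, k2, k3, k4, k5, k6⟩ := hl'
  unfold IMem at l1 l4 k1 k4
  intro u x hu1 hu2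
  have hMp := hS.pos
  have m1p := s1.pos
  have m2p := s2.pos
  have c1 := s1.mono (show a + 1 ≤ c by omega)
  have c2 := s1.mono (show c + 1 ≤ b by omega)
  have c3 := s1.mono (show b + 1 ≤ d by omega)
  have c4 := s1.mono (show d + 1 ≤ a + n by omega)
  have c5 := s2.mono (show a + 1 ≤ c by omega)
  have c6 := s2.mono (show c + 1 ≤ b by omega)
  have c7 := s2.mono (show b + 1 ≤ d by omega)
  have c8 := s2.mono (show d + 1 ≤ a + n by omega)
  have pa1 := s1.per a
  have pa2 := s2.per a
  -- bounds on x
  by_cases hx : u < x ∧ x < u + n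
  swap
  · have no : ∀ (F : ℤ → ℤ) (m : ℤ), IStar n F m → ¬ ISec F m u x := by
      rintro F m hF ⟨e1, e2⟩
      unfold IMem at e1
      have := hF.pos
      have p := hF.per u
      have q1 : u + 1 < x + 1 := hF.lt_of (by omega)
      have q2 : x + 1 < u + n + 1 := hF.lt_of (by
        have := hF.per (u + 1)
        rw [show u + n + 1 = u + 1 + n by ring]
        omega)
      omega
    have n1 := no _ _ hS
    have n2 := no _ _ s1
    have n3 := no _ _ s2
    tauto
  unfold ISec IMem
  have su1 := s1.step u
  have su2 := s2.step u
  -- values for u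
  have U : (u ≤ c ∧ G u = F1 u - F1 a ∧ G (u+1) = F1 (u+1) - F1 a ∧
        F1 a ≤ F1 u ∧ F1 u ≤ F1 c ∧ F2 a ≤ F2 u ∧ F2 u ≤ F2 c ∧ F1 (u+1) ≤ F1 c + 1 ∧ F2 (u+1) ≤ F2 c) ∨
      (c < u ∧ u ≤ b ∧ G u = F1 c + 1 - F1 a + F2 u - F2 c ∧ G (u+1) = F1 c + 1 - F1 a + F2 (u+1) - F2 c ∧
        F1 c + 1 ≤ F1 u ∧ F1 u ≤ F1 b ∧ F2 c ≤ F2 u ∧ F2 u ≤ F2 b ∧ F1 (u+1) ≤ F1 b ∧ F2 (u+1) ≤ F2 b + 1) ∨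
      (b < u ∧ u < d ∧ G u = F1 c + 1 - F1 a + F2 b + 1 - F2 c + F1 u - F1 b ∧
        G (u+1) = F1 c + 1 - F1 a + F2 b + 1 - F2 c + F1 (u+1) - F1 b ∧
        F1 b ≤ F1 u ∧ F1 u ≤ F1 d ∧ F2 b + 1 ≤ F2 u ∧ F2 u ≤ F2 d ∧ F1 (u+1) ≤ F1 d ∧ F2 (u+1) ≤ F2 d) ∨
      (d ≤ u ∧ G u = F1 c + 1 - F1 a + F2 b + 1 - F2 c + F1 d - F1 b + F2 u - F2 d ∧
        G (u+1) = F1 c + 1 - F1 a + F2 b + 1 - F2 c + F1 d - F1 b + F2 (u+1) - F2 d ∧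
        F1 d ≤ F1 u ∧ F1 u ≤ F1 (a+n) ∧ F2 d ≤ F2 u ∧ F2 u ≤ F2 (a+n) ∧ F1 (u+1) ≤ F1 (a+n) ∧ F2 (u+1) ≤ F2 (a+n)) := by
    rcases lt_or_ge c u with q1 | q1
    · rcases lt_or_ge b u with q2 | q2
      · rcases lt_or_ge u d with q3 | q3
        · right; right; left
          have := s1.mono (show b + 1 ≤ u by omega)
          have := s2.mono (show b + 1 ≤ u by omega)
          have := s1.mono (show u + 1 ≤ d by omega)
          have := s2.mono (show u + 1 ≤ d by omega)
          refine ⟨q2, q3, g3 _ (by omega) (by omega), g3 _ (by omega) (by omega), ?_⟩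
          omega
        · right; right; right
          have := s1.mono (show d ≤ u by omega)
          have := s2.mono (show d ≤ u by omega)
          have := s1.mono (show u + 1 ≤ a + n by omega)
          have := s2.mono (show u + 1 ≤ a + n by omega)
          refine ⟨q3, g4 _ (by omega) (by omega), g4 _ (by omega) (by omega), ?_⟩
          omega
      · right; left
        have := s1.mono (show c + 1 ≤ u by omega)
        have := s2.mono (show c + 1 ≤ u by omega)
        have := s1.mono (show u + 1 ≤ b + 1 by omega)
        have := s2.mono (show u + 1 ≤ b + 1 by omega)
        refine ⟨q1, q2, g2 _ (by omega) (by omega), g2 _ (by omega) (by omega), ?_⟩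
        have := s1.mono (show u ≤ b by omega)
        have := s2.mono (show u ≤ b by omega)
        omega
    · left
      have := s1.mono (show a ≤ u by omega)
      have := s2.mono (show a ≤ u by omega)
      have := s1.mono (show u + 1 ≤ c + 1 by omega)
      have := s2.mono (show u + 1 ≤ c + 1 by omega)
      have := s1.mono (show u ≤ c by omega)
      have := s2.mono (show u ≤ c by omega)
      refine ⟨q1, g1 _ (by omega) (by omega), g1 _ (by omega) (by omega), ?_⟩
      omega
  -- values for y = x + 1 in the window
  have Y : ∀ y, a < y → y ≤ a + n →
      (y ≤ c ∧ G y = F1 y - F1 a ∧ F1 a + 1 ≤ F1 y ∧ F1 y ≤ F1 c ∧ F2 a ≤ F2 y ∧ F2 y ≤ F2 c) ∨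
      (c < y ∧ y ≤ b ∧ G y = F1 c + 1 - F1 a + F2 y - F2 c ∧ F1 c + 1 ≤ F1 y ∧ F1 y ≤ F1 b ∧ F2 c ≤ F2 y ∧ F2 y ≤ F2 b) ∨
      (b < y ∧ y ≤ d ∧ G y = F1 c + 1 - F1 a + F2 b + 1 - F2 c + F1 y - F1 b ∧
        F1 b ≤ F1 y ∧ F1 y ≤ F1 d ∧ F2 b + 1 ≤ F2 y ∧ F2 y ≤ F2 d) ∨
      (d < y ∧ G y = F1 c + 1 - F1 a + F2 b + 1 - F2 c + F1 d - F1 b + F2 y - F2 d ∧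
        F1 d ≤ F1 y ∧ F1 y ≤ F1 (a + n) ∧ F2 d + 1 ≤ F2 y ∧ F2 y ≤ F2 (a + n)) := by
    intro y y1 y2
    rcases lt_or_ge c y with q1 | q1
    · rcases lt_or_ge b y with q2 | q2
      · rcases lt_or_ge d y with q3 | q3
        · right; right; right
          have := s1.mono (show d + 1 ≤ y by omega)
          have := s2.mono (show d + 1 ≤ y by omega)
          have := s1.mono y2
          have := s2.mono y2
          refine ⟨q3, g4 _ (by omega) (by omega), ?_⟩
          omega
        · right; right; left
          have := s1.mono (show b + 1 ≤ y by omega)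
          have := s2.mono (show b + 1 ≤ y by omega)
          have := s1.mono q3
          have := s2.mono q3
          refine ⟨q2, q3, g3 _ (by omega) (by omega), ?_⟩
          omega
      · right; left
        have := s1.mono (show c + 1 ≤ y by omega)
        have := s2.mono (show c + 1 ≤ y by omega)
        have := s1.mono q2
        have := s2.mono q2
        refine ⟨q1, q2, g2 _ (by omega) (by omega), ?_⟩
        omega
    · left
      have := s1.mono (show a + 1 ≤ y by omega)
      have := s2.mono (show a + 1 ≤ y by omega)
      have := s1.mono q1
      have := s2.mono q1
      refine ⟨q1, g1 _ (by omega) (by omega), ?_⟩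
      omega
  rcases le_or_gt (x + 1) (a + n) with hy | hy
  · have Yx := Y (x + 1) (by omega) hy
    clear Y g1 g2 g3 g4
    rcases U with U | U | U | U <;> rcases Yx with V | V | V | V <;> omega
  · have Yx := Y (x + 1 - n) (by omega) (by omega)
    have r1 := s1.per (x + 1 - n)
    have r2 := s2.per (x + 1 - n)
    have r3 := hS.per (x + 1 - n)
    rw [sub_add_cancel] at r1 r2 r3
    clear Y g1 g2 g3 g4
    rcases U with U | U | U | U <;> rcases Yx with V | V | V | V <;> omega



/-- Periodic extension of a relation given on a fundamental window. -/
def perExt (n a : ℤ) (Q : ℤ → ℤ → Prop) (u x : ℤ) : Prop :=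
  Q (a + (u - a) % n) (x - u + (a + (u - a) % n))

lemma perExt_win {n a : ℤ} {Q : ℤ → ℤ → Prop} {u : ℤ} (x : ℤ) (h1 : a ≤ u) (h2 : u < a + n) :
    perExt n a Q u x ↔ Q u x := by
  unfold perExt
  rw [Int.emod_eq_of_lt (by omega) (by omega), show a + (u - a) = u by ring, sub_add_cancel]

lemma perExt_shift {n a : ℤ} {Q : ℤ → ℤ → Prop} (u x : ℤ) :
    perExt n a Q (u + n) (x + n) ↔ perExt n a Q u x := by
  unfold perExt
  rw [show u + n - a = u - a + n by ring, Int.add_emod_right, show x + n - (u + n) = x - u by ring]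

lemma win_all {n : ℤ} (a : ℤ) (hn : 0 < n) {Q : ℤ → ℤ → Prop} (hQ : ∀ u w, Q (u + n) (w + n) ↔ Q u w)
    (h : ∀ u x, a ≤ u → u < a + n → Q u x) (u x : ℤ) : Q u x := by
  have w1 := Int.emod_nonneg (u - a) (show n ≠ 0 by omega)
  have w2 := Int.emod_lt_of_pos (u - a) hn
  have w3 := Int.emod_add_mul_ediv (u - a) n
  have := (shift_inv hQ ((u - a) / n) (a + (u - a) % n) (x - n * ((u - a) / n))).2 (h _ _ (by omega) (by omega))
  convert this using 1 <;> linarith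

lemma ILink.symm {n m1 m2 u v : ℤ} {F1 F2 : ℤ → ℤ} (s1 : IStar n F1 m1) (s2 : IStar n F2 m2)
    (h : ILink F1 m1 F2 m2 u v) : ILink F2 m2 F1 m1 v (u + n) := by
  obtain ⟨a1, a2, a3, a4, a5, a6⟩ := h
  have := s1.per u
  have := s1.per (u + 1)
  have := s2.per u
  have := s2.per (u + 1)
  unfold ILink IMem at *
  rw [show u + n + 1 = u + 1 + n by ring]
  omega

lemma ILink.shift {n m1 m2 u v : ℤ} {F1 F2 : ℤ → ℤ} (s1 : IStar n F1 m1) (s2 : IStar n F2 m2)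
    (h : ILink F1 m1 F2 m2 u v) : ILink F1 m1 F2 m2 (u + n) (v + n) :=
  ((h.symm s1 s2).symm s2 s1)

/-- The four new directed chords. -/
def ChW (n a b c d : ℤ) (u x : ℤ) : Prop :=
  (u = a ∧ x = b) ∨ (u = b ∧ x = a + n) ∨ (u = c ∧ x = d) ∨ (u = d ∧ x = c + n)

set_option maxHeartbeats 1600000 in
/-- All facts about splicing, in sector form. -/
lemma splice_spec {n m1 m2 a b c d : ℤ} {F1 F2 : ℤ → ℤ} (s1 : IStar n F1 m1) (s2 : IStar n F2 m2)
    (hl : ILink F1 m1 F2 m2 a b) (hl' : ILink F1 m1 F2 m2 c d)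
    (h1 : a < c) (h2 : c < b) (h3 : b < d) (h4 : d < a + n) :
    ∃ (G1 : ℤ → ℤ) (M1 : ℤ) (G2 : ℤ → ℤ) (M2 : ℤ) (W C : ℤ → ℤ → Prop),
      IStar n G1 M1 ∧ IStar n G2 M2 ∧
      (∀ u x, ISec G1 M1 u x ↔ (W u x ∧ ISec F1 m1 u x) ∨ (C u x ∧ ISec F2 m2 u x)) ∧
      (∀ u x, ISec G2 M2 u x ↔ (W u x ∧ ISec F2 m2 u x) ∨ (C u x ∧ ISec F1 m1 u x)) ∧
      (∀ u x, perExt n a (ChW n a b c d) u x ↔ (W u x ∧ C u (x - 1)) ∨ (C u x ∧ W u (x - 1))) ∧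
      (∀ u x, ¬ (W u x ∧ C u x)) ∧
      (∀ u x, perExt n a (ChW n a b c d) u x →
        (ISec F1 m1 u x ∧ ISec F1 m1 u (x - 1) ∧ ¬ IMem F2 u) ∨
        (ISec F2 m2 u x ∧ ISec F2 m2 u (x - 1) ∧ ¬ IMem F1 u)) ∧
      (∀ u x, ISec F1 m1 u x → W u x ∨ C u x) ∧ (∀ u x, ISec F2 m2 u x → W u x ∨ C u x) := by
  have hn := s1.npos
  obtain ⟨G1, M1, g1, r1⟩ := splice_sec s1 s2 hl hl' h1 h2 h3 h4
  obtain ⟨G2, M2, g2, r2⟩ := splice_sec s2 s1 (hl.symm s1 s2) (hl'.symm s1 s2) h3 h4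
    (show a + n < c + n by omega) (show c + n < b + n by omega)
  let W0 : ℤ → ℤ → Prop := fun u x => (u ≤ c ∧ b ≤ x ∧ x < d) ∨ (b ≤ u ∧ u ≤ d ∧ a + n ≤ x ∧ x < c + n)
  let C0 : ℤ → ℤ → Prop := fun u x => (u = a ∧ c ≤ x ∧ x < b) ∨ (c ≤ u ∧ u ≤ b ∧ d ≤ x ∧ x < a + n) ∨
    (d ≤ u ∧ c + n ≤ x ∧ x < b + n)
  have hx : ∀ x, x + n - 1 = x - 1 + n := fun x => by ring
  refine ⟨G1, M1, G2, M2, perExt n a W0, perExt n a C0, g1, g2, ?_, ?_, ?_, ?_, ?_, ?_, ?_⟩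
  · refine win_all a hn ?_ ?_
    · intro u w; simp only [perExt_shift, g1.sec_shift, s1.sec_shift, s2.sec_shift]
    · intro u x u1 u2
      rw [perExt_win _ u1 u2, perExt_win _ u1 u2]
      exact r1 u x u1 u2
  · refine win_all b hn ?_ ?_
    · intro u w; simp only [perExt_shift, g2.sec_shift, s1.sec_shift, s2.sec_shift]
    · intro u x u1 u2
      rw [r2 u x u1 u2]
      rcases lt_or_ge u (a + n) with u3 | u3
      · rw [perExt_win _ (by omega) u3, perExt_win _ (by omega) u3]
        have e1 : ISec F1 m1 u x → u < x + 1 := fun hh => s1.lt_of (by have := hh.2; have := s1.pos; omega)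
        have e2 : ISec F2 m2 u x → u < x + 1 := fun hh => s2.lt_of (by have := hh.2; have := s2.pos; omega)
        have e3 : W0 u x ↔ (u ≤ d ∧ a + n ≤ x ∧ x < c + n) ∨ (a + n ≤ u ∧ u ≤ c + n ∧ b + n ≤ x ∧ x < d + n) := by
          simp only [W0]; omega
        have e4 : C0 u x ↔ (u = b ∧ d ≤ x ∧ x < a + n) ∨ (d ≤ u ∧ u ≤ a + n ∧ c + n ≤ x ∧ x < b + n) ∨
            (c + n ≤ u ∧ d + n ≤ x ∧ x < a + n + n) := by
          simp only [C0]; omega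
        rw [e3, e4]
      · have e0 : perExt n a W0 u x ↔ W0 (u - n) (x - n) := by
          rw [← perExt_win (n := n) (a := a) (Q := W0) (x - n) (show a ≤ u - n by omega) (by omega), ← perExt_shift (u - n) (x - n), sub_add_cancel, sub_add_cancel]
        have e0' : perExt n a C0 u x ↔ C0 (u - n) (x - n) := by
          rw [← perExt_win (n := n) (a := a) (Q := C0) (x - n) (show a ≤ u - n by omega) (by omega), ← perExt_shift (u - n) (x - n), sub_add_cancel, sub_add_cancel]
        rw [e0, e0']
        have e3 : W0 (u - n) (x - n) ↔ (u ≤ d ∧ a + n ≤ x ∧ x < c + n) ∨ (a + n ≤ u ∧ u ≤ c + n ∧ b + n ≤ x ∧ x < d + n) := by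
          simp only [W0]; omega
        have e4 : C0 (u - n) (x - n) ↔ (u = b ∧ d ≤ x ∧ x < a + n) ∨ (d ≤ u ∧ u ≤ a + n ∧ c + n ≤ x ∧ x < b + n) ∨
            (c + n ≤ u ∧ d + n ≤ x ∧ x < a + n + n) := by
          simp only [C0]; omega
        rw [e3, e4]
  · refine win_all a hn ?_ ?_
    · intro u w; simp only [hx, perExt_shift]
    · intro u x u1 u2
      simp only [perExt_win _ u1 u2]
      simp only [W0, C0, ChW]; omega
  · refine win_all a hn ?_ ?_
    · intro u w; simp only [perExt_shift]
    · intro u x u1 u2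
      simp only [perExt_win _ u1 u2]
      simp only [W0, C0]; omega
  · refine win_all a hn ?_ ?_
    · intro u w; simp only [hx, perExt_shift, s1.sec_shift, s2.sec_shift, s1.mem_shift, s2.mem_shift]
    · intro u x u1 u2
      simp only [perExt_win _ u1 u2]
      have k1 := hl.symm s1 s2
      have k2 := hl'.symm s1 s2
      unfold ILink at hl hl' k1 k2
      unfold ISec
      unfold IMem at *
      rw [sub_add_cancel]
      rintro (⟨rfl, rfl⟩ | ⟨rfl, rfl⟩ | ⟨rfl, rfl⟩ | ⟨rfl, rfl⟩)
      · left; omega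
      · right; omega
      · left; omega
      · right; omega
  · refine win_all a hn ?_ ?_
    · intro u w; simp only [perExt_shift, s1.sec_shift]
    · intro u x u1 u2
      simp only [perExt_win _ u1 u2]
      rintro ⟨t1, t2⟩
      have k1 := hl.symm s1 s2
      have k2 := hl'.symm s1 s2
      have k3 := hl.shift s1 s2
      have p1 := s1.per a
      have p2 := s1.per b
      have p3 := s1.per c
      have p4 := s1.pos
      have c1 := s1.mono (show a + 1 ≤ c by omega)
      have c2 := s1.mono (show c + 1 ≤ b by omega)
      have c3 := s1.mono (show b + 1 ≤ d by omega)
      have c4 := s1.mono (show d + 1 ≤ a + n by omega)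
      unfold ILink at hl hl' k1 k2 k3
      unfold IMem at *
      have lo : ∀ p, F1 p < F1 (x + 1) → p ≤ x := fun p h => by have := s1.lt_of h; omega
      have hi : ∀ q, F1 (x + 1) < F1 (q + 1) → x < q := fun p h => by have := s1.lt_of h; omega
      clear r1 r2
      simp only [W0, C0]
      rcases lt_trichotomy u c with v1 | v1 | v1
      · rcases eq_or_lt_of_le u1 with v2 | v2
        · rw [← v2] at t1 t2 ⊢
          have := lo (c) (by omega); have := hi (d) (by omega); omega
        · have y1 := s1.mono (show a + 1 ≤ u by omega)
          have y2 := s1.mono (show u + 1 ≤ c by omega)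
          have := lo (b) (by omega); have := hi (d) (by omega); omega
      · rw [v1] at t1 t2 ⊢
        have := lo (b) (by omega); have := hi (a + n) (by omega); omega
      rcases lt_trichotomy u b with v2 | v2 | v2
      · have y1 := s1.mono (show c + 1 ≤ u by omega)
        have y2 := s1.mono (show u + 1 ≤ b by omega)
        have := lo (d) (by omega); have := hi (a + n) (by omega); omega
      · rw [v2] at t1 t2 ⊢
        omega
      rcases lt_trichotomy u d with v3 | v3 | v3
      · have y1 := s1.mono (show b + 1 ≤ u by omega)
        have y2 := s1.mono (show u + 1 ≤ d by omega)
        have := lo (a + n) (by omega); have := hi (c + n) (by omega); omega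
      · rw [v3] at t1 t2 ⊢
        omega
      · have y1 := s1.mono (show d + 1 ≤ u by omega)
        have y2 := s1.mono (show u + 1 ≤ a + n by omega)
        have := lo (c + n) (by omega); have := hi (b + n) (by omega); omega
  · refine win_all a hn ?_ ?_
    · intro u w; simp only [perExt_shift, s2.sec_shift]
    · intro u x u1 u2
      simp only [perExt_win _ u1 u2]
      rintro ⟨t1, t2⟩
      have k1 := hl.symm s1 s2
      have k2 := hl'.symm s1 s2
      have k3 := hl.shift s1 s2
      have p1 := s2.per a
      have p2 := s2.per b
      have p3 := s2.per c
      have p4 := s2.pos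
      have c1 := s2.mono (show a + 1 ≤ c by omega)
      have c2 := s2.mono (show c + 1 ≤ b by omega)
      have c3 := s2.mono (show b + 1 ≤ d by omega)
      have c4 := s2.mono (show d + 1 ≤ a + n by omega)
      unfold ILink at hl hl' k1 k2 k3
      unfold IMem at *
      have lo : ∀ p, F2 p < F2 (x + 1) → p ≤ x := fun p h => by have := s2.lt_of h; omega
      have hi : ∀ q, F2 (x + 1) < F2 (q + 1) → x < q := fun p h => by have := s2.lt_of h; omega
      clear r1 r2
      simp only [W0, C0]
      rcases lt_trichotomy u c with v1 | v1 | v1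
      · rcases eq_or_lt_of_le u1 with v2 | v2
        · rw [← v2] at t1 t2 ⊢
          omega
        · have y1 := s2.mono (show a + 1 ≤ u by omega)
          have y2 := s2.mono (show u + 1 ≤ c by omega)
          have := lo (b) (by omega); have := hi (d) (by omega); omega
      · rw [v1] at t1 t2 ⊢
        omega
      rcases lt_trichotomy u b with v2 | v2 | v2
      · have y1 := s2.mono (show c + 1 ≤ u by omega)
        have y2 := s2.mono (show u + 1 ≤ b by omega)
        have := lo (d) (by omega); have := hi (a + n) (by omega); omega
      · rw [v2] at t1 t2 ⊢
        have := lo (d) (by omega); have := hi (c + n) (by omega); omega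
      rcases lt_trichotomy u d with v3 | v3 | v3
      · have y1 := s2.mono (show b + 1 ≤ u by omega)
        have y2 := s2.mono (show u + 1 ≤ d by omega)
        have := lo (a + n) (by omega); have := hi (c + n) (by omega); omega
      · rw [v3] at t1 t2 ⊢
        have := lo (a + n) (by omega); have := hi (b + n) (by omega); omega
      · have y1 := s2.mono (show d + 1 ≤ u by omega)
        have y2 := s2.mono (show u + 1 ≤ a + n by omega)
        have := lo (c + n) (by omega); have := hi (b + n) (by omega); omega



lemma IStar.edge_iff {n m : ℤ} {F : ℤ → ℤ} (h : IStar n F m) (u w : ℤ) :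
    IEdge F m u w ↔ ISec F m u w ∧ ¬ ISec F m u (w - 1) := by
  unfold IEdge ISec IMem
  rw [sub_add_cancel]
  have := h.step w
  omega

lemma IStar.sec_lt {n m : ℤ} {F : ℤ → ℤ} (h : IStar n F m) {u x : ℤ} (hs : ISec F m u x) :
    u < x ∧ x < u + n := by
  obtain ⟨e1, e2⟩ := hs
  unfold IMem at e1
  have := h.pos
  have p := h.per u
  have q1 : u + 1 < x + 1 := h.lt_of (by omega)
  have q2 : x + 1 < u + n + 1 := h.lt_of (by
    have := h.per (u + 1)
    rw [show u + n + 1 = u + 1 + n by ring]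
    omega)
  omega

lemma prop_edge {W C W' C' A B A' B' Ch : Prop} (a1 : Ch ↔ (W ∧ C') ∨ (C ∧ W'))
    (a2 : A' → W' ∨ C') (a3 : B' → W' ∨ C') (p : (W ∧ A) ∨ (C ∧ B)) (q : ¬ ((W' ∧ A') ∨ (C' ∧ B'))) :
    (A ∧ ¬ A') ∨ (B ∧ ¬ B') ∨ Ch := by
  by_cases x1 : W' <;> by_cases x2 : C' <;> by_cases x3 : A' <;> by_cases x4 : B' <;>
    simp_all <;> tauto

lemma prop_cov {W C W' C' A B A' B' Ch : Prop} (a1 : Ch ↔ (W ∧ C') ∨ (C ∧ W'))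
    (f4 : Ch → (A ∧ A' ∧ ¬ B') ∨ (B ∧ B' ∧ ¬ A ∧ ¬ A')) (a2 : A → W ∨ C) (p : A) (q : ¬ A') :
    (((W ∧ A) ∨ (C ∧ B)) ∧ ¬ ((W' ∧ A') ∨ (C' ∧ B'))) ∨
    (((W ∧ B) ∨ (C ∧ A)) ∧ ¬ ((W' ∧ B') ∨ (C' ∧ A'))) := by
  by_cases x : Ch
  · have := f4 x; tauto
  · by_cases x1 : W <;> by_cases x2 : C <;> simp_all

lemma prop_chord {W C W' C' A B A' B' Ch : Prop} (a1 : Ch ↔ (W ∧ C') ∨ (C ∧ W'))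
    (f3 : ¬ (W' ∧ C')) (x : Ch) (p : A) (q : A') (r : ¬ B') :
    (((W ∧ A) ∨ (C ∧ B)) ∧ ¬ ((W' ∧ A') ∨ (C' ∧ B'))) ∨
    (((W ∧ B) ∨ (C ∧ A)) ∧ ¬ ((W' ∧ B') ∨ (C' ∧ A'))) := by
  have := a1.1 x
  simp_all
  tauto

lemma prop_nos {W C W' C' A B A' B' Ch Dd : Prop} (a1 : Ch ↔ (W ∧ C') ∨ (C ∧ W'))
    (f3 : ¬ (W ∧ C)) (f3' : ¬ (W' ∧ C'))
    (f4 : Ch → (A ∧ A' ∧ ¬ B' ∧ ¬ B) ∨ (B ∧ B' ∧ ¬ A ∧ ¬ A')) (n1 : A' → A → ¬ Dd) (n2 : B' → B → ¬ Dd)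
    (p : (W ∧ A) ∨ (C ∧ B)) (q : (W' ∧ A') ∨ (C' ∧ B')) : ¬ (Dd ∨ Ch) := by
  by_cases x : Ch
  · have := f4 x
    have := a1.1 x
    by_cases x1 : W <;> by_cases x2 : C <;> simp_all
  · by_cases x1 : W <;> by_cases x2 : C <;> simp_all

/-- Splicing two doubly linked stars yields a finer decomposition. -/
theorem IDecomp.merge {ι : Type} {n k : ℤ} {F : ι → ℤ → ℤ} {m : ι → ℤ} {Dd : ℤ → ℤ → Prop}
    (h : IDecomp n k F m Dd) {S S' : ι} (hne : S ≠ S') {a b c d : ℤ}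
    (hl : ILink (F S) (m S) (F S') (m S') a b) (hl' : ILink (F S) (m S) (F S') (m S') c d)
    (h1 : a < c) (h2 : c < b) (h3 : b < d) (h4 : d < a + n) (Dd' : ℤ → ℤ → Prop)
    (dsw : ∀ u v, Dd' u v → Dd' v (u + n)) (dper : ∀ u v, Dd' u (v + n) → Dd' u v)
    (dsym : ∀ u v, Dd' u v → Dd' v u)
    (hD : ∀ u v, u < v → v < u + n → (Dd' u v ↔ Dd u v ∨ perExt n a (ChW n a b c d) u v)) :
    ∃ F' m', IDecomp n k (ι := ι) F' m' Dd' := by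
  obtain ⟨G1, M1, G2, M2, W, C, g1, g2, r1, r2, f12, f3, f4, f5, f6⟩ :=
    splice_spec (h.st S) (h.st S') hl hl' h1 h2 h3 h4
  let F' : ι → ℤ → ℤ := fun T => if T = S then G1 else if T = S' then G2 else F T
  let m' : ι → ℤ := fun T => if T = S then M1 else if T = S' then M2 else m T
  have st : ∀ T, IStar n (F' T) (m' T) := by
    intro T
    simp only [F', m']
    split_ifs
    exacts [g1, g2, h.st T]
  have hS : ∀ u x, ISec (F' S) (m' S) u x ↔ (W u x ∧ ISec (F S) (m S) u x) ∨ (C u x ∧ ISec (F S') (m S') u x) := by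
    intro u x; simp only [F', m', if_true]; exact r1 u x
  have hS' : ∀ u x, ISec (F' S') (m' S') u x ↔ (W u x ∧ ISec (F S') (m S') u x) ∨ (C u x ∧ ISec (F S) (m S) u x) := by
    intro u x; simp only [F', m', if_true, if_neg hne.symm]; exact r2 u x
  have hT : ∀ T, T ≠ S → T ≠ S' → F' T = F T ∧ m' T = m T := by
    intro T t1 t2; simp only [F', m', if_neg t1, if_neg t2, and_self]
  have sm : ∀ {T : ι} {u x}, ISec (F T) (m T) u x → IMem (F T) u := fun hh => hh.1
  have su : ∀ u x, ISec (F S) (m S) u x → ISec (F S') (m S') u x → False :=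
    fun u x p q => hne (h.sec_uniq p q)
  -- every sector of a new star is a sector of an old one
  have cases3 : ∀ T : ι, T = S ∨ T = S' ∨ (T ≠ S ∧ T ≠ S') := fun T => by tauto
  have f4' : ∀ u x, perExt n a (ChW n a b c d) u x →
      (ISec (F S) (m S) u x ∧ ISec (F S) (m S) u (x - 1) ∧ ¬ ISec (F S') (m S') u (x - 1) ∧ ¬ ISec (F S') (m S') u x) ∨
      (ISec (F S') (m S') u x ∧ ISec (F S') (m S') u (x - 1) ∧ ¬ ISec (F S) (m S) u x ∧ ¬ ISec (F S) (m S) u (x - 1)) := by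
    intro u x hh
    rcases f4 u x hh with ⟨x1, x2, x3⟩ | ⟨x1, x2, x3⟩
    · exact Or.inl ⟨x1, x2, fun y => x3 y.1, fun y => x3 y.1⟩
    · exact Or.inr ⟨x1, x2, fun y => x3 y.1, fun y => x3 y.1⟩
  have fin : ∀ u w,
      ((((W u w ∧ ISec (F S) (m S) u w) ∨ (C u w ∧ ISec (F S') (m S') u w)) ∧
        ¬ ((W u (w - 1) ∧ ISec (F S) (m S) u (w - 1)) ∨ (C u (w - 1) ∧ ISec (F S') (m S') u (w - 1)))) ∨
       (((W u w ∧ ISec (F S') (m S') u w) ∨ (C u w ∧ ISec (F S) (m S) u w)) ∧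
        ¬ ((W u (w - 1) ∧ ISec (F S') (m S') u (w - 1)) ∨ (C u (w - 1) ∧ ISec (F S) (m S) u (w - 1))))) →
      ∃ T, IEdge (F' T) (m' T) u w := by
    rintro u w (q | q)
    · exact ⟨S, by rw [(st S).edge_iff, hS, hS]; exact q⟩
    · exact ⟨S', by rw [(st S').edge_iff, hS', hS']; exact q⟩
  have covE : ∀ T u w, IEdge (F T) (m T) u w → ∃ T, IEdge (F' T) (m' T) u w := by
    intro T u w he
    rcases cases3 T with rfl | rfl | ⟨t1, t2⟩
    · rw [(h.st T).edge_iff] at he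
      exact fin u w (prop_cov (f12 u w) (fun hh => (f4' u w hh).imp (fun y => ⟨y.1, y.2.1, y.2.2.1⟩) id)
        (f5 u w) he.1 he.2)
    · rw [(h.st T).edge_iff] at he
      exact fin u w (Or.symm (prop_cov (f12 u w) (fun hh => by
        rcases f4' u w hh with y | y
        · exact Or.inr ⟨y.1, y.2.1, y.2.2.2, y.2.2.1⟩
        · exact Or.inl ⟨y.1, y.2.1, y.2.2.2⟩) (f6 u w) he.1 he.2))
    · exact ⟨T, by rw [(hT T t1 t2).1, (hT T t1 t2).2]; exact he⟩
  refine ⟨F', m', ⟨st, h.kpos, h.hnk, dsw, dper, dsym, ?_, ?_, ?_, ?_, ?_, ?_⟩⟩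
  · intro u v huv p q
    rcases (hD u v p q).1 huv with hh | hh
    · exact h.dlen u v hh p q
    · rcases f4 u v hh with ⟨x1, x2, _⟩ | ⟨x1, x2, _⟩
      · obtain ⟨y, w, e1, e2, e3, e4, e5, e6, _⟩ := h.sides x1
        obtain ⟨y', w', e1', e2', e3', e4', e5', e6', _⟩ := h.sides x2
        omega
      · obtain ⟨y, w, e1, e2, e3, e4, e5, e6, _⟩ := h.sides x1
        obtain ⟨y', w', e1', e2', e3', e4', e5', e6', _⟩ := h.sides x2
        omega
  · intro T u w he
    have hlt := (st T).edge_lt he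
    have old : ∀ T, IEdge (F T) (m T) u w → w = u + k ∨ Dd' u w := by
      intro T hh
      rcases h.edge _ _ _ hh with q | q
      · exact Or.inl q
      · exact Or.inr ((hD u w hlt.1 hlt.2).2 (Or.inl q))
    have chd : perExt n a (ChW n a b c d) u w → w = u + k ∨ Dd' u w :=
      fun q => Or.inr ((hD u w hlt.1 hlt.2).2 (Or.inr q))
    have oldS : ISec (F S) (m S) u w → ¬ ISec (F S) (m S) u (w - 1) → w = u + k ∨ Dd' u w :=
      fun p q => old S (((h.st S).edge_iff u w).2 ⟨p, q⟩)
    have oldS' : ISec (F S') (m S') u w → ¬ ISec (F S') (m S') u (w - 1) → w = u + k ∨ Dd' u w :=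
      fun p q => old S' (((h.st S').edge_iff u w).2 ⟨p, q⟩)
    rcases cases3 T with rfl | rfl | ⟨t1, t2⟩
    · rw [(st T).edge_iff, hS, hS] at he
      rcases prop_edge (f12 u w) (f5 u (w - 1)) (f6 u (w - 1)) he.1 he.2 with q | q | q
      exacts [oldS q.1 q.2, oldS' q.1 q.2, chd q]
    · rw [(st T).edge_iff, hS', hS'] at he
      rcases prop_edge (f12 u w) (f6 u (w - 1)) (f5 u (w - 1)) he.1 he.2 with q | q | q
      exacts [oldS' q.1 q.2, oldS q.1 q.2, chd q]
    · rw [(hT T t1 t2).1, (hT T t1 t2).2] at he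
      exact old T he
  · intro u
    obtain ⟨T, hh⟩ := h.cov u
    exact covE T u _ hh
  · intro u w huw p q
    rcases (hD u w p q).1 huw with hh | hh
    · obtain ⟨T, hh⟩ := h.cov' u w hh p q
      exact covE T u _ hh
    · have key := f4' u w hh
      rcases key with ⟨x1, x2, x3, x4⟩ | ⟨x1, x2, x3, x4⟩
      · refine fin u w (prop_chord (f12 u w) (f3 u (w - 1)) hh x1 x2 x3)
      · refine fin u w (Or.symm (prop_chord (f12 u w) (f3 u (w - 1)) hh x1 x2 x4))
  · intro T T' u w e1 e2
    have i1 := ((st T).edge_iff u w).1 e1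
    have i2 := ((st T').edge_iff u w).1 e2
    have j1 := i1.1
    have j2 := i2.1
    have f3' := f3 u w
    have su' := su u w
    rcases cases3 T with rfl | rfl | ⟨t1, t2⟩ <;> rcases cases3 T' with t' | t' | ⟨t1', t2'⟩
    · exact t'.symm
    · subst t'; exfalso; rw [hS] at j1; rw [hS'] at j2; clear * - j1 j2 f3' su'; tauto
    · exfalso; rw [hS] at j1; rw [(hT T' t1' t2').1, (hT T' t1' t2').2] at j2
      rcases j1 with j1 | j1
      · exact t1' (h.sec_uniq j2 j1.2)
      · exact t2' (h.sec_uniq j2 j1.2)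
    · subst t'; exfalso; rw [hS] at j2; rw [hS'] at j1; clear * - j1 j2 f3' su'; tauto
    · exact t'.symm
    · exfalso; rw [hS'] at j1; rw [(hT T' t1' t2').1, (hT T' t1' t2').2] at j2
      rcases j1 with j1 | j1
      · exact t2' (h.sec_uniq j2 j1.2)
      · exact t1' (h.sec_uniq j2 j1.2)
    · subst t'
      exfalso; rw [hS] at j2; rw [(hT T t1 t2).1, (hT T t1 t2).2] at j1
      rcases j2 with j2 | j2
      · exact t1 (h.sec_uniq j1 j2.2)
      · exact t2 (h.sec_uniq j1 j2.2)
    · subst t'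
      exfalso; rw [hS'] at j2; rw [(hT T t1 t2).1, (hT T t1 t2).2] at j1
      rcases j2 with j2 | j2
      · exact t2 (h.sec_uniq j1 j2.2)
      · exact t1 (h.sec_uniq j1 j2.2)
    · rw [(hT T t1 t2).1, (hT T t1 t2).2] at j1
      rw [(hT T' t1' t2').1, (hT T' t1' t2').2] at j2
      exact h.sec_uniq j1 j2
  · intro T u x e1 e2
    have hlt := (st T).sec_lt e2
    rw [hD u x hlt.1 hlt.2]
    rcases cases3 T with rfl | rfl | ⟨t1, t2⟩
    · rw [hS] at e1 e2
      exact prop_nos (f12 u x) (f3 u x) (f3 u (x - 1)) (f4' u x) (h.nos T u x) (h.nos S' u x) e2 e1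
    · rw [hS'] at e1 e2
      exact prop_nos (f12 u x) (f3 u x) (f3 u (x - 1)) (fun hh => by
        rcases f4' u x hh with y | y
        · exact Or.inr ⟨y.1, y.2.1, y.2.2.2, y.2.2.1⟩
        · exact Or.inl ⟨y.1, y.2.1, y.2.2.2, y.2.2.1⟩) (h.nos T u x) (h.nos S u x) e2 e1
    · rw [(hT T t1 t2).1, (hT T t1 t2).2] at e1 e2
      rintro (hh | hh)
      · exact h.nos T u x e1 e2 hh
      · rcases f4' u x hh with y | y
        · exact t1 (h.sec_uniq e2 y.1)
        · exact t2 (h.sec_uniq e2 y.1)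



lemma CyclicPolygon.edge_ne (Q : CyclicPolygon) {p q : ℂ} (h : (p, q) ∈ Q.E) : p ≠ q := by
  obtain ⟨w, hw, _⟩ := Q.outdeg q (Q.endmem _ h).2
  exact (Q.acw _ _ _ h hw).1

lemma CyclicPolygon.next_eq (Q : CyclicPolygon) {p q : ℂ} (h : (p, q) ∈ Q.E) : Q.next p = q := by
  have hex : ∃ w, (p, w) ∈ Q.E := ⟨q, h⟩
  unfold CyclicPolygon.next
  rw [dif_pos hex]
  exact (Q.outdeg p (Q.endmem _ h).1).unique hex.choose_spec h

lemma CyclicPolygon.prev_eq (Q : CyclicPolygon) {p q : ℂ} (h : (p, q) ∈ Q.E) : Q.prev q = p := by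
  have hex : ∃ w, (w, q) ∈ Q.E := ⟨p, h⟩
  unfold CyclicPolygon.prev
  rw [dif_pos hex]
  exact (Q.indeg q (Q.endmem _ h).2).unique hex.choose_spec h

lemma Enum.inj_win {V : Finset ℂ} {n : ℤ} {e : ℤ → ℂ} (h : Enum V n e) {p i j : ℤ} (h1 : p ≤ i) (h2 : i < p + n)
    (h3 : p ≤ j) (h4 : j < p + n) (he : e i = e j) : i = j := by
  rcases le_total i j with hh | hh
  · exact h.inj i j hh (by omega) he
  · exact (h.inj j i hh (by omega) he.symm).symm

/-- Lift a pair of distinct vertices to the integers. -/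
lemma Enum.lift_pair {V : Finset ℂ} {n : ℤ} {e : ℤ → ℂ} (h : Enum V n e) {p q : ℂ} (hp : p ∈ V) (hq : q ∈ V)
    (hne : p ≠ q) : ∃ u w, e u = p ∧ e w = q ∧ u < w ∧ w < u + n := by
  obtain ⟨u, _, _, hu⟩ := h.surj p hp 0
  obtain ⟨w, w1, w2, hw⟩ := h.surj q hq u
  refine ⟨u, w, hu, hw, lt_of_le_of_ne w1 ?_, w2⟩
  rintro rfl
  exact hne (hu ▸ hw)

section
variable {P : CyclicPolygon} {n k : ℤ} {e : ℤ → ℂ}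

lemma poly_edge (h : Enum P.V n e) {kk : ℕ} (hk : ∀ e ∈ P.E, edgeLength P e.1 e.2 = kk) {u w : ℤ}
    (h1 : u < w) (h2 : w < u + n) : (e u, e w) ∈ P.E ↔ w = u + kk := by
  have fwd : ∀ w, u < w → w < u + n → (e u, e w) ∈ P.E → w = u + kk := by
    intro w h1 h2 hE
    have := hk _ hE
    unfold edgeLength at this
    have hc := arc_ncard h (U := P.V) (Finset.Subset.refl _) (F := fun x => x)
      (fun x => ⟨fun _ => rfl, fun hx => absurd (h.mem x) hx⟩) h1 h2
    simp only at this hc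
    omega
  refine ⟨fwd w h1 h2, ?_⟩
  intro hw
  obtain ⟨v, hv, _⟩ := P.outdeg (e u) (h.mem u)
  obtain ⟨j, j1, j2, rfl⟩ := h.surj v (P.endmem _ hv).2 u
  have hne := P.edge_ne hv
  have : j ≠ u := fun hh => hne (by rw [hh])
  have := fwd j (by omega) j2 hv
  rw [hw, ← this]
  exact hv

lemma poly_kpos (h : Enum P.V n e) {kk : ℕ} (hk : ∀ e ∈ P.E, edgeLength P e.1 e.2 = kk) : 1 ≤ kk := by
  obtain ⟨v, hv, _⟩ := P.outdeg (e 0) (h.mem 0)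
  have := hk _ hv
  unfold edgeLength at this
  omega

lemma poly_link (h : Enum P.V n e) {kk : ℕ} (hk : ∀ e ∈ P.E, edgeLength P e.1 e.2 = kk) (hnk : 2 * (kk : ℤ) + 1 ≤ n)
    {u v : ℤ} (h1 : u < v) (h2 : v < u + n) :
    Linkable P (e u) (e v) ↔ u + kk < v ∧ v < u + n - kk := by
  have k1 := poly_kpos h hk
  have hE : ∀ u, (e u, e (u + kk)) ∈ P.E := fun u => (poly_edge h hk (by omega) (by omega)).2 rfl
  have key : ∀ u v, u < v → v < u + n → (SplitsVertexAngle P (e u) (e v) ↔ u + kk < v ∧ v < u + n - kk) := by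
    intro u v h1 h2
    have e1 := P.next_eq (hE u)
    have e2 : P.prev (e u) = e (u + n - kk) := by
      have := P.prev_eq (hE (u + n - kk))
      rwa [sub_add_cancel, h.per] at this
    unfold SplitsVertexAngle
    rw [e1, e2, ← h.split u (u + kk) (u + n - kk) v (by omega) (by omega) (by omega) h1 h2]
    unfold SplitsAngle3
    exact ⟨fun hh => hh.2, fun hh => ⟨h.mem u, hh⟩⟩
  unfold Linkable LinkablePair
  rw [key u v h1 h2]
  have := key v (u + n) (by omega) (by omega)
  rw [h.per] at this
  rw [this]
  constructor
  · rintro ⟨_, hh, _⟩; exact hh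
  · intro hh
    refine ⟨fun he => ?_, hh, by omega, by omega⟩
    have := h.inj u v (by omega) h2 he
    omega

/-- A geometric star decomposition yields an integer one. -/
lemma decomp_to_int (h : Enum P.V n e) {kk : ℕ} (hk : ∀ e ∈ P.E, edgeLength P e.1 e.2 = kk)
    (hnk : 2 * (kk : ℤ) + 1 ≤ n) {D : Set (Sym2 ℂ)} {𝒮 : Finset CyclicPolygon} (hd : IsStarDecomp P D 𝒮) :
    ∃ (F : {S // S ∈ 𝒮} → ℤ → ℤ) (m : {S // S ∈ 𝒮} → ℤ), (∀ S, StarRep P.V n e S.1 (F S) (m S)) ∧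
      IDecomp n kk F m (fun u v => s(e u, e v) ∈ D) := by
  obtain ⟨d1, d2, d3, d4, d5, d6⟩ := hd
  have k1 := poly_kpos h hk
  have ex : ∀ S : {S // S ∈ 𝒮}, ∃ (F : ℤ → ℤ) (m : ℤ), StarRep P.V n e S.1 F m := by
    intro S
    obtain ⟨⟨q, q0, hq⟩, hs⟩ := d2 S.1 S.2
    obtain ⟨F, hF⟩ := star_to_int h S.1 (by exact_mod_cast hs) q q0 hq
    exact ⟨F, q, hF⟩
  choose F m hr using ex
  have toE : ∀ S u w, IEdge (F S) (m S) u w → (e u, e w) ∈ S.1.E := fun S u w he =>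
    ((hr S).edge u w ((hr S).st.edge_lt he).1 ((hr S).st.edge_lt he).2).2 he
  refine ⟨F, m, hr, ⟨fun S => (hr S).st, by exact_mod_cast k1, hnk, ?_, ?_, ?_, ?_, ?_, ?_, ?_, ?_, ?_⟩⟩
  · intro u v huv; simp only [h.per]; rw [Sym2.eq_swap]; exact huv
  · intro u v huv; simp only [h.per] at huv; exact huv
  · intro u v huv; rw [Sym2.eq_swap]; exact huv
  · intro u v huv p q
    exact (poly_link h hk hnk p q).1 (d1 _ _ huv)
  · intro S u w he
    have hlt := (hr S).st.edge_lt he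
    rcases d3 S.1 S.2 (toE S u w he) with hh | hh
    · exact Or.inl ((poly_edge h hk hlt.1 hlt.2).1 hh)
    · exact Or.inr hh
  · intro u
    obtain ⟨S, hS, hh⟩ := d4 (e u, e (u + kk)) (Or.inl ((poly_edge h hk (by omega) (by omega)).2 rfl))
    exact ⟨⟨S, hS⟩, ((hr ⟨S, hS⟩).edge u _ (by omega) (by omega)).1 hh⟩
  · intro u w huw p q
    obtain ⟨S, hS, hh⟩ := d4 (e u, e w) (Or.inr huw)
    exact ⟨⟨S, hS⟩, ((hr ⟨S, hS⟩).edge u _ p q).1 hh⟩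
  · intro S S' u w h1 h2
    by_contra hne
    exact d5 S.1 S.2 S'.1 S'.2 (fun hh => hne (Subtype.ext hh)) _ (toE _ _ _ h1) (toE _ _ _ h2)
  · intro S u x s1 s2 hD
    have hst := (hr S).st
    obtain ⟨y, y1, y2⟩ := hst.hit (F S u + m S)
    obtain ⟨w, w1, w2⟩ := hst.hit (F S u + m S + 1)
    have ey : IEdge (F S) (m S) u y := ⟨s1.1, y2, y1⟩
    have ew : IEdge (F S) (m S) w (u + n) := ⟨w2, (hst.mem_shift u).2 s1.1, by have := hst.per u; omega⟩
    have hw := toE _ _ _ ew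
    rw [h.per] at hw
    have l1 := hst.edge_lt ey
    have l2 := hst.edge_lt ew
    have v1 := s1.2
    have v2 := s2.2
    rw [sub_add_cancel] at v1
    unfold IMem at y2 w2
    have a1 : y < x := hst.lt_of (by omega)
    have a2 : x + 1 < w + 1 := hst.lt_of (by omega)
    refine d6 S.1 S.2 _ _ _ hw (toE _ _ _ ey) ⟨e x, hD, ?_⟩
    rw [h.split u y w x l1.1 (by omega) (by omega) (by omega) (by omega)]
    omega

/-- An integer star decomposition yields a geometric one. -/
lemma int_to_decomp (h : Enum P.V n e) {kk : ℕ} (hk : ∀ e ∈ P.E, edgeLength P e.1 e.2 = kk)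
    (hnk : 2 * (kk : ℤ) + 1 ≤ n) {D : Set (Sym2 ℂ)} (hDV : ∀ x y, s(x, y) ∈ D → x ∈ P.V ∧ y ∈ P.V ∧ x ≠ y)
    {ι : Type} [Fintype ι] {F : ι → ℤ → ℤ} {m : ι → ℤ}
    (hI : IDecomp n kk F m (fun u v => s(e u, e v) ∈ D)) : HasStarDecomp P D := by
  choose T hT using fun S => int_to_star h P.onCircle (F S) (m S) (hI.st S)
  have lift : ∀ S p q, (p, q) ∈ (T S).E → ∃ u w, e u = p ∧ e w = q ∧ u < w ∧ w < u + n ∧ IEdge (F S) (m S) u w := by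
    intro S p q hpq
    have hm := (T S).endmem _ hpq
    obtain ⟨u, w, rfl, rfl, h1, h2⟩ := h.lift_pair ((hT S).sub hm.1) ((hT S).sub hm.2) ((T S).edge_ne hpq)
    exact ⟨u, w, rfl, rfl, h1, h2, ((hT S).edge u w h1 h2).1 hpq⟩
  refine ⟨Finset.univ.image T, ?_, ?_, ?_, ?_, ?_, ?_⟩
  · intro x y hxy
    obtain ⟨h1, h2, h3⟩ := hDV x y hxy
    obtain ⟨u, v, rfl, rfl, p, q⟩ := h.lift_pair h1 h2 h3
    exact (poly_link h hk hnk p q).2 (hI.dlen u v hxy p q)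
  · intro S hS
    obtain ⟨i, _, rfl⟩ := Finset.mem_image.1 hS
    refine ⟨⟨(m i).toNat, by have := (hI.st i).pos; omega, (hT i).kst⟩, ?_⟩
    exact_mod_cast (hT i).sub
  · intro S hS
    obtain ⟨i, _, rfl⟩ := Finset.mem_image.1 hS
    rintro ⟨p, q⟩ hpq
    obtain ⟨u, w, rfl, rfl, h1, h2, he⟩ := lift i p q hpq
    rcases hI.edge i u w he with hh | hh
    · exact Or.inl ((poly_edge h hk h1 h2).2 hh)
    · exact Or.inr hh
  · rintro ⟨p, q⟩ hpq
    rcases hpq with hpq | hpq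
    · have hpq' : (p, q) ∈ P.E := hpq
      have hm := P.endmem _ hpq'
      obtain ⟨u, w, rfl, rfl, h1, h2⟩ := h.lift_pair hm.1 hm.2 (P.edge_ne hpq')
      have hw := (poly_edge h hk h1 h2).1 hpq'
      subst hw
      obtain ⟨i, hi⟩ := hI.cov u
      exact ⟨T i, Finset.mem_image_of_mem _ (Finset.mem_univ i), ((hT i).edge u _ h1 h2).2 hi⟩
    · have hpq' : s(p, q) ∈ D := hpq
      obtain ⟨m1, m2, m3⟩ := hDV p q hpq'
      obtain ⟨u, w, rfl, rfl, h1, h2⟩ := h.lift_pair m1 m2 m3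
      obtain ⟨i, hi⟩ := hI.cov' u w hpq' h1 h2
      exact ⟨T i, Finset.mem_image_of_mem _ (Finset.mem_univ i), ((hT i).edge u _ h1 h2).2 hi⟩
  · intro S1 hS1 S2 hS2 hne
    obtain ⟨i, _, rfl⟩ := Finset.mem_image.1 hS1
    obtain ⟨j, _, rfl⟩ := Finset.mem_image.1 hS2
    rintro ⟨p, q⟩ h1 h2
    obtain ⟨u, w, rfl, rfl, l1, l2, he⟩ := lift i p q h1
    exact hne (by rw [hI.disj i j u w he (((hT j).edge u w l1 l2).1 h2)])
  · intro S hS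
    obtain ⟨i, _, rfl⟩ := Finset.mem_image.1 hS
    rintro p q r hpq hqr ⟨x, hx, hsp⟩
    obtain ⟨u, y, rfl, rfl, l1, l2, he⟩ := lift i q r hqr
    obtain ⟨m1, m2, m3⟩ := hDV _ _ hx
    obtain ⟨z, z1, z2, rfl⟩ := h.surj x m2 u
    have z3 : z ≠ u := fun hh => m3 (by rw [hh])
    obtain ⟨l, t1, t2, rfl⟩ := h.surj p ((hT i).sub ((T i).endmem _ hpq).1) u
    have t3 : l ≠ u := fun hh => (T i).edge_ne hpq (by rw [hh])
    rw [← h.per u] at hpq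
    have he2 := ((hT i).edge l (u + n) (by omega) (by omega)).1 hpq
    have hst := hI.st i
    have v1 := he.2.2
    have v2 := he2.2.2
    have v3 := hst.per u
    have v4 : F i l = F i u + m i + 1 := by omega
    have v5 : y < l := hst.lt_of (by omega)
    rw [h.split u y l z l1 v5 (by omega) (by omega) (by omega)] at hsp
    exact hI.nos i u z (hI.sec_of he v4 (by omega) (by omega)) (hI.sec_of he v4 (by omega) (by omega)) hx

end

lemma chord_iff {V : Finset ℂ} {n : ℤ} {e : ℤ → ℂ} (h : Enum V n e) {a b c d : ℤ}
    (h1 : a < c) (h2 : c < b) (h3 : b < d) (h4 : d < a + n) (u v : ℤ) :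
    u < v → v < u + n → ((s(e u, e v) = s(e a, e b) ∨ s(e u, e v) = s(e c, e d)) ↔
      perExt n a (ChW n a b c d) u v) := by
  revert u v
  refine win_all a h.npos ?_ ?_
  · intro u w
    simp only [perExt_shift, h.per]
    rw [show u + n < w + n ↔ u < w by omega, show w + n < u + n + n ↔ w < u + n by omega]
  · intro u v u1 u2 v1 v2
    rw [perExt_win _ u1 u2, Sym2.eq_iff, Sym2.eq_iff]
    unfold ChW
    have inj := fun {p i j : ℤ} => h.inj_win (p := p) (i := i) (j := j)
    constructor
    · rintro ((⟨x, y⟩ | ⟨x, y⟩) | (⟨x, y⟩ | ⟨x, y⟩))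
      · have q := inj u1 u2 (show a ≤ a by omega) (by omega) x
        subst q
        exact Or.inl ⟨rfl, inj (p := u) (by omega) (by omega) (by omega) (by omega) y⟩
      · have q := inj u1 u2 (show a ≤ b by omega) (by omega) x
        subst q
        rw [← h.per a] at y
        exact Or.inr (Or.inl ⟨rfl, inj (p := u) (by omega) (by omega) (by omega) (by omega) y⟩)
      · have q := inj u1 u2 (show a ≤ c by omega) (by omega) x
        subst q
        exact Or.inr (Or.inr (Or.inl ⟨rfl, inj (p := u) (by omega) (by omega) (by omega) (by omega) y⟩))
      · have q := inj u1 u2 (show a ≤ d by omega) (by omega) x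
        subst q
        rw [← h.per c] at y
        exact Or.inr (Or.inr (Or.inr ⟨rfl, inj (p := u) (by omega) (by omega) (by omega) (by omega) y⟩))
    · rintro (⟨rfl, rfl⟩ | ⟨rfl, rfl⟩ | ⟨rfl, rfl⟩ | ⟨rfl, rfl⟩) <;> simp [h.per]

theorem k_triangulation_aux (n k : ℕ) (hnk : 2 * k + 1 ≤ n) (P : CyclicPolygon)
    (hn : P.V.card = n) (hk : ∀ e ∈ P.E, edgeLength P e.1 e.2 = k)
    (D : Set (Sym2 ℂ)) (𝒮 : Finset CyclicPolygon) (h : IsMaximalStarDecomp P D 𝒮) :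
    ∀ S ∈ 𝒮, IsKStar S k := by
  intro S hS
  obtain ⟨hd, hmax⟩ := h
  obtain ⟨e, he⟩ := exists_enum P.V P.nonempty P.onCircle
  rw [hn] at he
  have hnk' : 2 * (k : ℤ) + 1 ≤ n := by exact_mod_cast hnk
  obtain ⟨F, m, hr, hI⟩ := decomp_to_int he hk hnk' hd
  rcases hI.main ⟨S, hS⟩ with hh | ⟨S', a, b, c, d, hne, l1, l2, o1, o2⟩
  · have := (hr ⟨S, hS⟩).kst
    rw [hh] at this
    simpa using this
  · exfalso
    obtain ⟨a, b, c, d, l1, l2, h1, h2, h3, h4⟩ := hI.normal l1 l2 o1 o2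
    set D' : Set (Sym2 ℂ) := D ∪ {s(e a, e b), s(e c, e d)} with hD'
    have hmem : ∀ x, x ∈ D' ↔ x ∈ D ∨ (x = s(e a, e b) ∨ x = s(e c, e d)) := by
      intro x; simp [hD']; tauto
    obtain ⟨F', m', hI'⟩ := hI.merge hne l1 l2 h1 h2 h3 h4 (fun u v => s(e u, e v) ∈ D')
      (fun u v huv => by simp only [he.per]; rw [Sym2.eq_swap]; exact huv)
      (fun u v huv => by simp only [he.per] at huv; exact huv)
      (fun u v huv => by rw [Sym2.eq_swap]; exact huv)
      (fun u v p q => by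
        rw [hmem, chord_iff he h1 h2 h3 h4 u v p q])
    refine hmax D' ?_ (int_to_decomp he hk hnk' ?_ hI')
    · refine ⟨Set.subset_union_left, fun hsub => ?_⟩
      have hin : s(e a, e b) ∈ D := hsub ((hmem _).2 (Or.inr (Or.inl rfl)))
      refine hI.nos ⟨S, hS⟩ a b ⟨l1.1, ?_⟩ ⟨l1.1, l1.2.2.1⟩ hin
      rw [sub_add_cancel]
      exact l1.2.1
    · have nab : e a ≠ e b := fun hh => by
        have := he.inj a b (by omega) (by omega) hh
        omega
      have ncd : e c ≠ e d := fun hh => by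
        have := he.inj c d (by omega) (by omega) hh
        omega
      intro x y hxy
      rcases (hmem _).1 hxy with hh | hh | hh
      · have hL := hd.1 x y hh
        exact ⟨hL.2.1.1, hL.2.2.1, hL.1⟩
      · rcases Sym2.eq_iff.1 hh with ⟨rfl, rfl⟩ | ⟨rfl, rfl⟩
        · exact ⟨he.mem _, he.mem _, nab⟩
        · exact ⟨he.mem _, he.mem _, nab.symm⟩
      · rcases Sym2.eq_iff.1 hh with ⟨rfl, rfl⟩ | ⟨rfl, rfl⟩
        · exact ⟨he.mem _, he.mem _, ncd⟩
        · exact ⟨he.mem _, he.mem _, ncd.symm⟩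


/-- Every maximal star decomposition of the cyclic polygon `Pₙᵏ` (with `n`
vertices, all edges of length `k`, `2k + 1 ≤ n`) is a `k`-star decomposition. -/
theorem k_triangulation (n k : ℕ) (hnk : 2 * k + 1 ≤ n) (P : CyclicPolygon)
    (hn : P.V.card = n) (hk : ∀ e ∈ P.E, edgeLength P e.1 e.2 = k)
    (D : Set (Sym2 ℂ)) (𝒮 : Finset CyclicPolygon) (h : IsMaximalStarDecomp P D 𝒮) :
    ∀ S ∈ 𝒮, IsKStar S k := by
  exact k_triangulation_aux n k hnk P hn hk D 𝒮 h

end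
end

section
/- For every cyclic polygon P(V,E), there exists a positive integer r such that the sum over all v ∈ V of the exterior angles π − ∠v⁻vv⁺ equals 2πr. -/
open Complex
open scoped Classical

noncomputable section

theorem posArc_pos (u v : ℂ) : 0 < posArc u v := by
  unfold posArc
  have := Complex.neg_pi_lt_arg (v / u)
  have := Real.pi_pos
  split_ifs <;> linarith

theorem posArc_le (u v : ℂ) : posArc u v ≤ 2 * Real.pi := by
  unfold posArc
  have := Complex.arg_le_pi (v / u)
  have := Real.pi_pos
  split_ifs <;> linarith

theorem exp_posArc {u v : ℂ} (hu : ‖u‖ = 1) (hv : ‖v‖ = 1) :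
    Complex.exp (posArc u v * I) = v / u := by
  have h : Complex.exp (Complex.arg (v / u) * I) = v / u := by
    have := Complex.norm_mul_exp_arg_mul_I (v / u)
    rwa [norm_div, hu, hv, div_one, Complex.ofReal_one, one_mul] at this
  unfold posArc
  split_ifs
  · exact h
  · push_cast
    rw [add_mul, Complex.exp_add, h, Complex.exp_two_pi_mul_I, mul_one]

theorem posArc_unique {u v : ℂ} (hu : ‖u‖ = 1) (hv : ‖v‖ = 1) {t : ℝ} (h0 : 0 < t)
    (h1 : t < 2 * Real.pi) (h : Complex.exp (t * I) = v / u) : posArc u v = t := by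
  have h2 := exp_posArc hu hv
  rw [← h, Complex.exp_eq_exp_iff_exists_int] at h2
  obtain ⟨n, hn⟩ := h2
  have hn' : posArc u v = t + n * (2 * Real.pi) := by
    have := congrArg Complex.im hn
    simpa using this
  have h3 := posArc_pos u v
  have h4 := posArc_le u v
  have hp := Real.pi_pos
  have a1 : n < 1 := by
    by_contra hc
    have : (1 : ℝ) ≤ n := by exact_mod_cast not_lt.mp hc
    nlinarith
  have a2 : -1 < n := by
    by_contra hc
    have : (n : ℝ) ≤ -1 := by exact_mod_cast not_lt.mp hc
    nlinarith
  have : n = 0 := by omega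
  subst this
  simpa using hn'

theorem vangle_eq {u v w : ℂ} (hu : ‖u‖ = 1) (hv : ‖v‖ = 1) (hw : ‖w‖ = 1)
    (h : ACW u v w) : vangle u v w = Real.pi - (posArc u v + posArc v w) / 2 := by
  obtain ⟨huv, hvw, huw, hlt⟩ := h
  have ea := exp_posArc hu hv
  have ec := exp_posArc hu hw
  have ha0 := posArc_pos u v
  have hcle := posArc_le u w
  have hp := Real.pi_pos
  have u0 : u ≠ 0 := by intro h; simp [h] at hu
  have hc2 : posArc u w < 2 * Real.pi := by
    refine lt_of_le_of_ne hcle ?_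
    intro hc
    rw [hc] at ec
    push_cast at ec
    rw [Complex.exp_two_pi_mul_I, eq_div_iff u0, one_mul] at ec
    exact huw ec
  generalize posArc u v = a at *
  generalize posArc u w = c at *
  have hv' : v = Complex.exp (a * I) * u := by rw [ea]; field_simp
  have hw' : w = Complex.exp (c * I) * u := by rw [ec]; field_simp
  have hb : posArc v w = c - a := by
    apply posArc_unique hv hw (by linarith) (by linarith)
    rw [hv', hw', mul_div_mul_right _ _ u0, ← Complex.exp_sub]
    push_cast
    ring_nf
  rw [hb]
  have hs1 : 0 < Real.sin (a / 2) := Real.sin_pos_of_pos_of_lt_pi (by linarith) (by linarith)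
  have hs2 : 0 < Real.sin ((c - a) / 2) :=
    Real.sin_pos_of_pos_of_lt_pi (by linarith) (by linarith)
  have hd : w - v ≠ 0 := sub_ne_zero.mpr hvw.symm
  have key : (u - v) / (w - v) = ((Real.sin (a / 2) / Real.sin ((c - a) / 2) : ℝ) : ℂ) *
      (Complex.cos ((Real.pi - c / 2 : ℝ) : ℂ) + Complex.sin ((Real.pi - c / 2 : ℝ) : ℂ) * I) := by
    have hs2' : Complex.sin ((c - a) / 2) ≠ 0 := by exact_mod_cast hs2.ne'
    rw [div_eq_iff hd, hv', hw', ← Complex.exp_mul_I]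
    push_cast
    rw [sub_mul, Complex.exp_sub, Complex.exp_pi_mul_I]
    field_simp
    have e1 : Complex.exp (a * I) = Complex.exp (a / 2 * I) ^ 2 := by
      rw [← Complex.exp_nat_mul]; congr 1; push_cast; ring
    have e2 : Complex.exp (I * c) = Complex.exp (c / 2 * I) ^ 2 := by
      rw [← Complex.exp_nat_mul]; congr 1; push_cast; ring
    have s1 : Complex.sin (a / 2) = (Complex.exp (a / 2 * I) - (Complex.exp (a / 2 * I))⁻¹) / (2 * I) := by
      rw [← Complex.exp_neg, Complex.sin]
      field_simp
      rw [I_sq]; ring_nf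
    have s2 : Complex.sin ((c - a) / 2) = (Complex.exp (c / 2 * I) / Complex.exp (a / 2 * I) -
        Complex.exp (a / 2 * I) / (Complex.exp (c / 2 * I))) / (2 * I) := by
      rw [← Complex.exp_sub, ← Complex.exp_sub, Complex.sin]
      field_simp
      rw [I_sq]; ring_nf
    have e3 : Complex.exp (I * c / 2) = Complex.exp (c / 2 * I) := by ring_nf
    rw [e3, s1, s2, e1, e2]
    have := Complex.exp_ne_zero (a / 2 * I)
    have := Complex.exp_ne_zero (c / 2 * I)
    generalize Complex.exp (a / 2 * I) = A at *
    generalize Complex.exp (c / 2 * I) = C at *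
    field_simp
    ring
  unfold vangle
  rw [key, Complex.arg_mul_cos_add_sin_mul_I (div_pos hs1 hs2) ⟨by linarith, by linarith⟩,
    abs_of_pos (by linarith)]
  ring

theorem next_mem (P : CyclicPolygon) {v : ℂ} (hv : v ∈ P.V) : (v, P.next v) ∈ P.E := by
  have h : ∃ w, (v, w) ∈ P.E := (P.outdeg v hv).exists
  unfold CyclicPolygon.next
  rw [dif_pos h]
  exact h.choose_spec

theorem prev_mem (P : CyclicPolygon) {v : ℂ} (hv : v ∈ P.V) : (P.prev v, v) ∈ P.E := by
  have h : ∃ u, (u, v) ∈ P.E := (P.indeg v hv).exists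
  unfold CyclicPolygon.prev
  rw [dif_pos h]
  exact h.choose_spec

/-- For every cyclic polygon, the sum of its exterior angles is `2πr` for
some positive integer `r` (the rotation number). -/
theorem rotation_number_exists (P : CyclicPolygon) :
    ∃ r : ℕ, 0 < r ∧ ∑ v ∈ P.V, (Real.pi - interiorAngle P v) = 2 * Real.pi * r := by
  have nV : ∀ v ∈ P.V, P.next v ∈ P.V := fun v hv => (P.endmem _ (next_mem P hv)).2
  have pV : ∀ v ∈ P.V, P.prev v ∈ P.V := fun v hv => (P.endmem _ (prev_mem P hv)).1
  have np : ∀ v ∈ P.V, P.next (P.prev v) = v := fun v hv =>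
    (P.outdeg _ (pV v hv)).unique (next_mem P (pV v hv)) (prev_mem P hv)
  have pn : ∀ v ∈ P.V, P.prev (P.next v) = v := fun v hv =>
    (P.indeg _ (nV v hv)).unique (prev_mem P (nV v hv)) (next_mem P hv)
  have hsum : ∑ v ∈ P.V, (Real.pi - interiorAngle P v) =
      ∑ v ∈ P.V, posArc v (P.next v) := by
    have h1 : ∑ v ∈ P.V, posArc (P.prev v) v = ∑ v ∈ P.V, posArc v (P.next v) :=
      Finset.sum_nbij' P.prev P.next pV nV np pn (fun v hv => by rw [np v hv])
    have h2 : ∀ v ∈ P.V, Real.pi - interiorAngle P v =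
        posArc (P.prev v) v / 2 + posArc v (P.next v) / 2 := by
      intro v hv
      unfold interiorAngle
      rw [vangle_eq (P.onCircle _ (pV v hv)) (P.onCircle _ hv) (P.onCircle _ (nV v hv))
        (P.acw _ _ _ (prev_mem P hv) (next_mem P hv))]
      ring
    rw [Finset.sum_congr rfl h2, Finset.sum_add_distrib, ← Finset.sum_div, ← Finset.sum_div, h1]
    ring
  have hpos : 0 < ∑ v ∈ P.V, posArc v (P.next v) :=
    Finset.sum_pos (fun v _ => posArc_pos _ _) P.nonempty
  have hexp : Complex.exp ((∑ v ∈ P.V, posArc v (P.next v) : ℝ) * I) = 1 := by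
    push_cast
    rw [Finset.sum_mul, Complex.exp_sum]
    rw [Finset.prod_congr rfl (fun v hv =>
      exp_posArc (P.onCircle v hv) (P.onCircle _ (nV v hv))), Finset.prod_div_distrib]
    have h1 : ∏ v ∈ P.V, P.next v = ∏ v ∈ P.V, v :=
      Finset.prod_nbij' P.next P.prev nV pV pn np (fun v hv => rfl)
    rw [h1]
    apply div_self
    rw [Finset.prod_ne_zero_iff]
    intro v hv h
    have := P.onCircle v hv
    simp [h] at this
  rw [hsum]
  rw [Complex.exp_eq_one_iff] at hexp
  obtain ⟨n, hn⟩ := hexp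
  have hn' : ∑ v ∈ P.V, posArc v (P.next v) = n * (2 * Real.pi) := by
    have := congrArg Complex.im hn
    simpa using this
  have n0 : 0 < n := by
    rw [hn'] at hpos
    have := pos_of_mul_pos_left hpos (by positivity)
    exact_mod_cast this
  lift n to ℕ using n0.le
  refine ⟨n, by exact_mod_cast n0, ?_⟩
  rw [hn']
  push_cast
  ring

end
end
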